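/- (Adiprasito–Huh–Katz; Rota–Welsh conjecture) Let M be a loopless matroid of rank r on a finite ground set E, and write its characteristic polynomial as χ_M(t) = Σ_{k=0}^{r} w_k(M) t^{r−k}. Then the unsigned Whitney numbers of the first kind w_k^+(M) := (−1)^k w_k(M) are nonnegative and form a log-concave sequence w_0^+(M), w_1^+(M), …, w_r^+(M); in particular this sequence is unimodal. -/

import Mathlib

/-- A matroid on a finite ground set `E`, given by the independence axioms (I1)-(I3). -/
structure FinMatroid (E : Type*) [Fintype E] [DecidableEq E] where
  Indep : Finset E → Prop
  indep_empty : Indep ∅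
  indep_subset : ∀ ⦃I J : Finset E⦄, Indep J → I ⊆ J → Indep I
  indep_exchange : ∀ ⦃I J : Finset E⦄, Indep I → Indep J → I.card < J.card →
    ∃ e ∈ J, e ∉ I ∧ Indep (insert e I)

namespace FinMatroid

variable {E : Type*} [Fintype E] [DecidableEq E]

open Classical in
/-- The rank of a subset `A`: the maximal cardinality of an independent subset of `A`. -/
noncomputable def rank (M : FinMatroid E) (A : Finset E) : ℕ :=
  (A.powerset.filter fun I => M.Indep I).sup Finset.card

/-- The rank of the matroid. -/
noncomputable def rk (M : FinMatroid E) : ℕ := M.rank Finset.univ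

/-- The closure of a subset `A`: all elements `x` with `r(A ∪ {x}) = r(A)`. -/
noncomputable def closure (M : FinMatroid E) (A : Finset E) : Finset E :=
  Finset.univ.filter fun x => M.rank (insert x A) = M.rank A

/-- A flat is a closed subset. -/
def IsFlat (M : FinMatroid E) (F : Finset E) : Prop := M.closure F = F

/-- A matroid is loopless if the closure of the empty set is empty. -/
def Loopless (M : FinMatroid E) : Prop := M.closure ∅ = ∅

/-- A basis is a maximal independent set. -/
def IsBase (M : FinMatroid E) (B : Finset E) : Prop :=
  M.Indep B ∧ ∀ ⦃J⦄, M.Indep J → B ⊆ J → J = B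

open Classical in
/-- The finset of all flats of `M`. -/
noncomputable def flats (M : FinMatroid E) : Finset (Finset E) :=
  Finset.univ.filter fun F => M.IsFlat F

open Classical in
/-- `mu` is the Möbius function of the lattice of flats of `M`: it satisfies `mu F F = 1`,
`mu F F' = 0` when `¬ F ⊆ F'`, and for `F ⊂ F'` the sum of `mu F G` over the flats
`F ⊆ G ⊆ F'` vanishes. These properties determine `mu` uniquely on pairs of flats. -/
def IsMobius (M : FinMatroid E) (mu : Finset E → Finset E → ℤ) : Prop :=
  (∀ F ∈ M.flats, mu F F = 1) ∧
  (∀ F ∈ M.flats, ∀ F' ∈ M.flats, ¬F ⊆ F' → mu F F' = 0) ∧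
  (∀ F ∈ M.flats, ∀ F' ∈ M.flats, F ⊂ F' →
    ∑ G ∈ M.flats.filter (fun G => F ⊆ G ∧ G ⊆ F'), mu F G = 0)

open Classical in
/-- The characteristic polynomial of a matroid `M` (relative to the Möbius function `mu` of
its lattice of flats): `χ_M(t) = Σ_{F ∈ L(M)} μ(∅,F) t^{r(E) - r(F)}` if `M` is loopless,
and `0` if `M` has a loop. -/
noncomputable def charPoly (M : FinMatroid E) (mu : Finset E → Finset E → ℤ) : Polynomial ℤ :=
  if M.Loopless then
    ∑ F ∈ M.flats, Polynomial.C (mu ∅ F) * Polynomial.X ^ (M.rk - M.rank F)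
  else 0

end FinMatroid



namespace RW

/-- Abstract balanced flag complex with a space `W` of linear functions. -/
structure Cx (V : Type*) [Fintype V] [DecidableEq V] where
  adj : V → V → Prop
  adj_symm : ∀ ⦃a b⦄, adj a b → adj b a
  adj_irrefl : ∀ a, ¬ adj a a
  N : ℕ
  Face : Finset V → Prop
  W : Submodule ℝ (V → ℝ)
  face_insert : ∀ ⦃τ G⦄, Face τ → (∀ F ∈ τ, adj F G) → Face (insert G τ)
  link_nonempty : ∀ ⦃τ⦄, Face τ → τ.card < N → ∃ G, ∀ F ∈ τ, adj F G
  dual : ∀ ⦃τ F⦄, Face τ → F ∈ τ → ∃ l ∈ W, l F = 1 ∧ ∀ F' ∈ τ, F' ≠ F → l F' = 0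

namespace Cx

variable {V : Type*} [Fintype V] [DecidableEq V] (C : Cx V)

open Classical in
/-- The vertices of the link of a face. -/
noncomputable def lk (τ : Finset V) : Finset V :=
  Finset.univ.filter fun G => ∀ F ∈ τ, C.adj F G

variable {C}

theorem mem_lk {τ : Finset V} {G : V} : G ∈ C.lk τ ↔ ∀ F ∈ τ, C.adj F G := by
  simp [lk]

theorem mem_lk_insert {τ : Finset V} {G H : V} :
    H ∈ C.lk (insert G τ) ↔ C.adj G H ∧ H ∈ C.lk τ := by
  simp [mem_lk]

theorem not_mem_of_mem_lk {τ : Finset V} {G : V} (h : G ∈ C.lk τ) : G ∉ τ :=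
  fun hG => C.adj_irrefl G (mem_lk.1 h G hG)

theorem face_ins {τ : Finset V} {G : V} (hτ : C.Face τ) (h : G ∈ C.lk τ) :
    C.Face (insert G τ) := C.face_insert hτ (mem_lk.1 h)

theorem card_ins {τ : Finset V} {G : V} (h : G ∈ C.lk τ) :
    (insert G τ).card = τ.card + 1 := Finset.card_insert_of_notMem (not_mem_of_mem_lk h)

theorem sum_lk_swap (τ : Finset V) (f : V → V → ℝ) :
    ∑ G ∈ C.lk τ, ∑ H ∈ C.lk (insert G τ), f G H =
      ∑ G ∈ C.lk τ, ∑ H ∈ C.lk (insert G τ), f H G := by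
  refine Finset.sum_comm' ?_
  intro x y
  simp only [mem_lk_insert]
  have := @C.adj_symm x y
  have := @C.adj_symm y x
  tauto

variable (C)

open Classical in
/-- A chosen dual function. -/
noncomputable def dl (τ : Finset V) (F : V) : V → ℝ :=
  if h : C.Face τ ∧ F ∈ τ then (C.dual h.1 h.2).choose else 0

/-- Interpolation of `y` on `τ` by a linear function. -/
noncomputable def ip (τ : Finset V) (y : V → ℝ) : V → ℝ :=
  fun G => ∑ F ∈ τ, y F * C.dl τ F G

/-- The mixed degree. -/
noncomputable def Phi : List (V → ℝ) → Finset V → ℝ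
  | [], _ => 1
  | y :: ys, τ => ∑ G ∈ C.lk τ, (y G - C.ip τ y G) * Phi ys (insert G τ)

variable {C}

theorem dl_spec {τ : Finset V} {F : V} (hτ : C.Face τ) (hF : F ∈ τ) :
    C.dl τ F ∈ C.W ∧ C.dl τ F F = 1 ∧ ∀ F' ∈ τ, F' ≠ F → C.dl τ F F' = 0 := by
  have h : C.Face τ ∧ F ∈ τ := ⟨hτ, hF⟩
  rw [dl, dif_pos h]
  exact (C.dual h.1 h.2).choose_spec

theorem ip_mem {τ : Finset V} (hτ : C.Face τ) (y : V → ℝ) : C.ip τ y ∈ C.W := by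
  have : C.ip τ y = ∑ F ∈ τ, y F • C.dl τ F := by
    ext G; simp [ip]
  rw [this]
  exact Submodule.sum_mem _ fun F hF => Submodule.smul_mem _ _ (dl_spec hτ hF).1

theorem ip_eq {τ : Finset V} (hτ : C.Face τ) (y : V → ℝ) {F : V} (hF : F ∈ τ) :
    C.ip τ y F = y F := by
  rw [ip, Finset.sum_eq_single F]
  · rw [(dl_spec hτ hF).2.1, mul_one]
  · intro F' hF' hne
    rw [(dl_spec hτ hF').2.2 F hF hne.symm, mul_zero]
  · exact fun h => absurd hF h

theorem ip_add (τ : Finset V) (y z : V → ℝ) : C.ip τ (y + z) = C.ip τ y + C.ip τ z := by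
  ext G; simp [ip, add_mul, Finset.sum_add_distrib]

theorem ip_smul (τ : Finset V) (c : ℝ) (y : V → ℝ) : C.ip τ (c • y) = c • C.ip τ y := by
  ext G; simp [ip, mul_assoc, Finset.mul_sum]

/-- The balancing condition in codimension one. -/
def Balanced (C : Cx V) : Prop :=
  ∀ ⦃τ⦄, C.Face τ → τ.card + 1 = C.N → ∀ l ∈ C.W, (∀ F ∈ τ, l F = 0) → ∑ G ∈ C.lk τ, l G = 0

theorem Phi_nil (τ : Finset V) : C.Phi [] τ = 1 := rfl

theorem Phi_cons (y : V → ℝ) (ys : List (V → ℝ)) (τ : Finset V) :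
    C.Phi (y :: ys) τ = ∑ G ∈ C.lk τ, (y G - C.ip τ y G) * C.Phi ys (insert G τ) := rfl

theorem sum_lin_aux {τ : Finset V} {ys : List (V → ℝ)} (hτ : C.Face τ)
    (IH : ∀ l ∈ C.W, (∀ F ∈ τ, l F = 0) → ∑ G ∈ C.lk τ, l G * C.Phi ys (insert G τ) = 0)
    (y l : V → ℝ) (hl : l ∈ C.W) (h : ∀ F ∈ τ, l F = y F) :
    C.Phi (y :: ys) τ = ∑ G ∈ C.lk τ, (y G - l G) * C.Phi ys (insert G τ) := by
  have := IH (l - C.ip τ y) (Submodule.sub_mem _ hl (ip_mem hτ y))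
    (fun F hF => by simp [ip_eq hτ y hF, h F hF])
  rw [Phi_cons, ← sub_eq_zero, ← Finset.sum_sub_distrib, ← this]
  refine Finset.sum_congr rfl fun G _ => ?_
  simp only [Pi.sub_apply]; ring

theorem sum_lin (hC : C.Balanced) (ys : List (V → ℝ)) : ∀ {τ : Finset V}, C.Face τ →
    τ.card + ys.length + 1 = C.N → ∀ l ∈ C.W, (∀ F ∈ τ, l F = 0) →
    ∑ G ∈ C.lk τ, l G * C.Phi ys (insert G τ) = 0 := by
  induction ys with
  | nil =>
    intro τ hτ hc l hl h0
    simpa [Phi_nil] using hC hτ (by simpa using hc) l hl h0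
  | cons y ys ih =>
    intro τ hτ hc l hl h0
    simp only [List.length_cons] at hc
    set y0 : V → ℝ := y - C.ip τ y with hy0
    have hy0z : ∀ F ∈ τ, y0 F = 0 := fun F hF => by simp [hy0, ip_eq hτ y hF]
    have key : ∀ G ∈ C.lk τ, l G * C.Phi (y :: ys) (insert G τ) =
        ∑ H ∈ C.lk (insert G τ), (l G * y0 H - y0 G * l H) *
          C.Phi ys (insert H (insert G τ)) := by
      intro G hG
      have hf := face_ins hτ hG
      have hcc := card_ins hG
      have IH := fun l' hl' h' => ih hf (by omega) l' hl' h'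
      by_cases hlG : l G = 0
      · rw [hlG, zero_mul]
        have := IH l hl (by
          intro F hF
          rcases Finset.mem_insert.1 hF with rfl | hF
          · exact hlG
          · exact h0 F hF)
        calc (0:ℝ) = -y0 G * ∑ H ∈ C.lk (insert G τ), l H * C.Phi ys (insert H (insert G τ)) := by
              rw [this]; simp
          _ = _ := by
              rw [Finset.mul_sum]
              refine Finset.sum_congr rfl fun H _ => ?_
              ring
      · have := sum_lin_aux hf IH y (C.ip τ y + (y0 G / l G) • l)
          (Submodule.add_mem _ (ip_mem hτ y) (Submodule.smul_mem _ _ hl)) (by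
            intro F hF
            rcases Finset.mem_insert.1 hF with rfl | hF
            · simp [hlG, hy0]
            · simp [h0 F hF, ip_eq hτ y hF])
        rw [this, Finset.mul_sum]
        refine Finset.sum_congr rfl fun H _ => ?_
        simp only [hy0, Pi.add_apply, Pi.smul_apply, smul_eq_mul, Pi.sub_apply]
        field_simp
        ring
    rw [Finset.sum_congr rfl key]
    have hs := sum_lk_swap (C := C) τ (fun G H => (l G * y0 H - y0 G * l H) *
          C.Phi ys (insert H (insert G τ)))
    have hneg : ∑ G ∈ C.lk τ, ∑ H ∈ C.lk (insert G τ), (l H * y0 G - y0 H * l G) *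
          C.Phi ys (insert G (insert H τ)) = - ∑ G ∈ C.lk τ, ∑ H ∈ C.lk (insert G τ),
          (l G * y0 H - y0 G * l H) * C.Phi ys (insert H (insert G τ)) := by
      simp only [← Finset.sum_neg_distrib]
      refine Finset.sum_congr rfl fun G _ => Finset.sum_congr rfl fun H _ => ?_
      rw [Finset.insert_comm G H]; ring
    linarith

theorem Phi_eq (hC : C.Balanced) {τ : Finset V} {ys : List (V → ℝ)} (hτ : C.Face τ)
    (hc : τ.card + ys.length + 1 = C.N)
    (y l : V → ℝ) (hl : l ∈ C.W) (h : ∀ F ∈ τ, l F = y F) :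
    C.Phi (y :: ys) τ = ∑ G ∈ C.lk τ, (y G - l G) * C.Phi ys (insert G τ) :=
  sum_lin_aux hτ (sum_lin hC ys hτ hc) y l hl h

/-- Expansion of `Phi` at an inserted vertex. -/
theorem Phi_ins (hC : C.Balanced) {τ : Finset V} {ys : List (V → ℝ)} (hτ : C.Face τ)
    (hc : τ.card + ys.length + 2 = C.N) (z : V → ℝ) {G : V} (hG : G ∈ C.lk τ) (m : V → ℝ)
    (hm : m ∈ C.W) (hm0 : ∀ F ∈ τ, m F = 0) (hm1 : m G = 1) :
    C.Phi (z :: ys) (insert G τ) =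
      ∑ H ∈ C.lk (insert G τ), ((z - C.ip τ z) H - (z - C.ip τ z) G * m H) *
        C.Phi ys (insert H (insert G τ)) := by
  rw [Phi_eq hC (face_ins hτ hG) (by rw [card_ins hG]; omega) z
    (C.ip τ z + ((z - C.ip τ z) G) • m)
    (Submodule.add_mem _ (ip_mem hτ z) (Submodule.smul_mem _ _ hm))]
  · refine Finset.sum_congr rfl fun H _ => ?_
    simp only [Pi.add_apply, Pi.smul_apply, smul_eq_mul, Pi.sub_apply]
    ring
  · intro F hF
    rcases Finset.mem_insert.1 hF with rfl | hF
    · simp [hm1]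
    · simp [hm0 F hF, ip_eq hτ z hF]

/-- Diagonal entries. -/
noncomputable def dg (C : Cx V) (ys : List (V → ℝ)) (τ : Finset V) (G : V) : ℝ :=
  ∑ H ∈ C.lk (insert G τ), C.dl (insert G τ) G H * C.Phi ys (insert H (insert G τ))

theorem Phi_ins' (hC : C.Balanced) {τ : Finset V} {ys : List (V → ℝ)} (hτ : C.Face τ)
    (hc : τ.card + ys.length + 2 = C.N) (z : V → ℝ) {G : V} (hG : G ∈ C.lk τ) :
    C.Phi (z :: ys) (insert G τ) =
      ∑ H ∈ C.lk (insert G τ), (z - C.ip τ z) H * C.Phi ys (insert H (insert G τ))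
        - (z - C.ip τ z) G * C.dg ys τ G := by
  have hs := dl_spec (face_ins hτ hG) (Finset.mem_insert_self G τ)
  rw [Phi_ins hC hτ hc z hG (C.dl (insert G τ) G) hs.1
    (fun F hF => hs.2.2 F (Finset.mem_insert_of_mem hF)
      (fun h => not_mem_of_mem_lk hG (h ▸ hF))) hs.2.1, dg, Finset.mul_sum,
      ← Finset.sum_sub_distrib]
  refine Finset.sum_congr rfl fun H _ => ?_
  ring

theorem Phi_swap (hC : C.Balanced) {τ : Finset V} {ys : List (V → ℝ)} (hτ : C.Face τ)
    (hc : τ.card + ys.length + 2 = C.N) (y z : V → ℝ) :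
    C.Phi (y :: z :: ys) τ = C.Phi (z :: y :: ys) τ := by
  have key : ∀ y z : V → ℝ, C.Phi (y :: z :: ys) τ =
      ∑ G ∈ C.lk τ, ∑ H ∈ C.lk (insert G τ), (y - C.ip τ y) G * (z - C.ip τ z) H *
        C.Phi ys (insert H (insert G τ)) -
      ∑ G ∈ C.lk τ, (y - C.ip τ y) G * (z - C.ip τ z) G * C.dg ys τ G := by
    intro y z
    rw [Phi_cons, ← Finset.sum_sub_distrib]
    refine Finset.sum_congr rfl fun G hG => ?_
    rw [Phi_ins' hC hτ hc z hG, mul_sub, Finset.mul_sum]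
    congr 1
    · refine Finset.sum_congr rfl fun H _ => ?_
      simp only [Pi.sub_apply]; ring
    · simp only [Pi.sub_apply]; ring
  rw [key, key, sum_lk_swap]
  congr 1
  · refine Finset.sum_congr rfl fun G _ => Finset.sum_congr rfl fun H _ => ?_
    rw [Finset.insert_comm G H]; ring
  · refine Finset.sum_congr rfl fun G _ => ?_
    ring

theorem Phi_perm (hC : C.Balanced) {ys zs : List (V → ℝ)} (h : ys.Perm zs) :
    ∀ {τ : Finset V}, C.Face τ → τ.card + ys.length = C.N → C.Phi ys τ = C.Phi zs τ := by
  induction h with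
  | nil => intros; rfl
  | cons y h ih =>
    intro τ hτ hc
    rw [Phi_cons, Phi_cons]
    refine Finset.sum_congr rfl fun G hG => ?_
    rw [ih (face_ins hτ hG) (by rw [card_ins hG]; simp at hc; omega)]
  | swap y z l =>
    intro τ hτ hc
    exact Phi_swap hC hτ (by simpa [add_assoc] using hc) _ _
  | trans h1 h2 ih1 ih2 =>
    intro τ hτ hc
    rw [ih1 hτ hc, ih2 hτ (by rw [← h1.length_eq]; exact hc)]

theorem Phi_add (y z : V → ℝ) (ys : List (V → ℝ)) (τ : Finset V) :
    C.Phi ((y + z) :: ys) τ = C.Phi (y :: ys) τ + C.Phi (z :: ys) τ := by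
  simp only [Phi_cons, ip_add, ← Finset.sum_add_distrib]
  refine Finset.sum_congr rfl fun G _ => ?_
  simp only [Pi.add_apply]; ring

theorem Phi_smul (c : ℝ) (y : V → ℝ) (ys : List (V → ℝ)) (τ : Finset V) :
    C.Phi ((c • y) :: ys) τ = c * C.Phi (y :: ys) τ := by
  simp only [Phi_cons, ip_smul, Finset.mul_sum]
  refine Finset.sum_congr rfl fun G _ => ?_
  simp only [Pi.smul_apply, smul_eq_mul]; ring

theorem Phi_continuous (fs : List (ℝ → V → ℝ)) (hf : ∀ f ∈ fs, Continuous f) :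
    ∀ τ : Finset V, Continuous fun e : ℝ => C.Phi (fs.map fun f => f e) τ := by
  induction fs with
  | nil => intro τ; simpa [Phi_nil] using continuous_const
  | cons f fs ih =>
    intro τ
    simp only [List.map_cons, Phi_cons, ip]
    have hc : ∀ G, Continuous fun e => f e G := fun G =>
      (continuous_apply G).comp (hf f (by simp))
    have h2 := ih (fun g hg => hf g (by simp [hg]))
    refine continuous_finsetSum _ fun G _ => ?_
    refine Continuous.mul (Continuous.sub (hc G) ?_) (h2 _)
    exact continuous_finsetSum _ fun F _ => (hc F).mul continuous_const

/-- Positivity: `v` is ample if on every face it is strictly convex. -/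
def Ample (C : Cx V) (v : V → ℝ) : Prop :=
  ∀ ⦃τ⦄, C.Face τ → ∃ l ∈ C.W, (∀ F ∈ τ, l F = v F) ∧ ∀ G ∈ C.lk τ, 0 < v G - l G

/-- Weak positivity. -/
def Nef (C : Cx V) (v : V → ℝ) : Prop :=
  ∀ ⦃τ⦄, C.Face τ → ∃ l ∈ C.W, (∀ F ∈ τ, l F = v F) ∧ ∀ G ∈ C.lk τ, 0 ≤ v G - l G

theorem Nef.add {v w : V → ℝ} (hv : C.Nef v) (hw : C.Nef w) : C.Nef (v + w) := by
  intro τ hτ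
  obtain ⟨l, hl, h1, h2⟩ := hv hτ
  obtain ⟨m, hm, h3, h4⟩ := hw hτ
  refine ⟨l + m, Submodule.add_mem _ hl hm, fun F hF => by simp [h1 F hF, h3 F hF], fun G hG => ?_⟩
  have := h2 G hG
  have := h4 G hG
  simp only [Pi.add_apply]; linarith

theorem Nef.add_ample {v w : V → ℝ} (hv : C.Nef v) (hw : C.Ample w) {e : ℝ} (he : 0 < e) :
    C.Ample (v + e • w) := by
  intro τ hτ
  obtain ⟨l, hl, h1, h2⟩ := hv hτ
  obtain ⟨m, hm, h3, h4⟩ := hw hτ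
  refine ⟨l + e • m, Submodule.add_mem _ hl (Submodule.smul_mem _ _ hm),
    fun F hF => by simp [h1 F hF, h3 F hF], fun G hG => ?_⟩
  have := h2 G hG
  have := mul_pos he (h4 G hG)
  simp only [Pi.add_apply, Pi.smul_apply, smul_eq_mul]; linarith

theorem Phi_pos (hC : C.Balanced) (vs : List (V → ℝ)) (hv : ∀ v ∈ vs, C.Ample v) :
    ∀ {τ : Finset V}, C.Face τ → τ.card + vs.length = C.N → 0 < C.Phi vs τ := by
  induction vs with
  | nil => intros; simp [Phi_nil]
  | cons v vs ih =>
    intro τ hτ hc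
    simp only [List.length_cons] at hc
    obtain ⟨l, hl, h1, h2⟩ := hv v (by simp) hτ
    rw [Phi_eq hC hτ (by omega) v l hl h1]
    obtain ⟨G, hG⟩ := C.link_nonempty hτ (by omega)
    refine Finset.sum_pos (fun G hG => mul_pos (h2 G hG) ?_) ⟨G, mem_lk.2 hG⟩
    exact ih (fun w hw => hv w (by simp [hw])) (face_ins hτ hG) (by rw [card_ins hG]; omega)

end Cx
end RW


namespace RW

section LA
variable {ι : Type*} [Fintype ι] [DecidableEq ι]

theorem la_eig (H : ι → ι → ℝ) (hsymm : ∀ i j, H i j = H j i) (hoff : ∀ i j, i ≠ j → 0 ≤ H i j)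
    (p : ι → ℝ) (hp : ∀ i, 0 < p i) (h : ι → ℝ) (hh : ∀ i, h i = ∑ j, H i j * p j)
    (hpos : ∀ i, 0 < h i)
    (conn : ∀ z : ι → ℝ, (∀ i j, i ≠ j → 0 < H i j → z i = z j) → ∀ i j, z i = z j)
    (key : ∀ x : ι → ℝ, ∑ i, x i * ∑ j, H i j * x j ≤ ∑ i, p i * (∑ j, H i j * x j) ^ 2 / h i)
    (x : ι → ℝ) (c : ℝ) (hc : 0 < c) (hx : ∀ i, ∑ j, H i j * x j = c * (h i / p i) * x i) :
    ∀ i j, x i / p i = x j / p j := by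
  set Q := ∑ i, h i / p i * x i ^ 2 with hQ
  have h1 := key x
  simp only [hx] at h1
  have e1 : ∑ i, x i * (c * (h i / p i) * x i) = c * Q := by
    rw [hQ, Finset.mul_sum]; refine Finset.sum_congr rfl fun i _ => ?_; ring
  have e2 : ∑ i, p i * (c * (h i / p i) * x i) ^ 2 / h i = c * (c * Q) := by
    rw [hQ, Finset.mul_sum, Finset.mul_sum]; refine Finset.sum_congr rfl fun i _ => ?_
    have := (hp i).ne'; have := (hpos i).ne'
    field_simp
  rw [e1, e2] at h1
  have h2 : Q ≤ c * Q := le_of_mul_le_mul_left h1 hc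
  -- identity
  have e3 : ∑ i, ∑ j, H i j * p i * p j * (x i / p i - x j / p j) ^ 2 = 2 * (Q - c * Q) := by
    have a1 : ∀ i j, H i j * p i * p j * (x i / p i - x j / p j) ^ 2 =
        (x i ^ 2 / p i) * (H i j * p j) + (x j ^ 2 / p j) * (H j i * p i)
          - 2 * (x i * (H i j * x j)) := by
      intro i j
      have := (hp i).ne'; have := (hp j).ne'
      rw [hsymm j i]
      field_simp
      ring
    simp only [a1, Finset.sum_sub_distrib, Finset.sum_add_distrib]
    have a2 : ∑ i, ∑ j, x i ^ 2 / p i * (H i j * p j) = Q := by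
      rw [hQ]; refine Finset.sum_congr rfl fun i _ => ?_
      rw [← Finset.mul_sum, ← hh]; ring
    have a3 : ∑ i, ∑ j, x j ^ 2 / p j * (H j i * p i) = Q := by
      rw [Finset.sum_comm]; exact a2
    have a4 : ∑ i, ∑ j, 2 * (x i * (H i j * x j)) = 2 * (c * Q) := by
      rw [← e1, Finset.mul_sum]; refine Finset.sum_congr rfl fun i _ => ?_
      rw [← hx, Finset.mul_sum, Finset.mul_sum]
    rw [a2, a3, a4]; ring
  have nn : ∀ i j, 0 ≤ H i j * p i * p j * (x i / p i - x j / p j) ^ 2 := by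
    intro i j
    by_cases hij : i = j
    · subst hij; simp
    · have := hoff i j hij; have := hp i; have := hp j; positivity
  have z : ∑ i, ∑ j, H i j * p i * p j * (x i / p i - x j / p j) ^ 2 = 0 :=
    le_antisymm (by rw [e3]; linarith)
      (Finset.sum_nonneg fun i _ => Finset.sum_nonneg fun j _ => nn i j)
  refine conn (fun i => x i / p i) fun i j _ hH => ?_
  rw [Finset.sum_eq_zero_iff_of_nonneg
    (fun i _ => Finset.sum_nonneg fun j _ => nn i j)] at z
  have z1 := z i (Finset.mem_univ _)
  rw [Finset.sum_eq_zero_iff_of_nonneg (fun j _ => nn i j)] at z1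
  have z2 := z1 j (Finset.mem_univ _)
  have := (mul_pos (mul_pos hH (hp i)) (hp j)).ne'
  have z3 := (mul_eq_zero.1 z2).resolve_left this
  have := pow_eq_zero_iff (two_ne_zero) |>.1 z3
  simpa [sub_eq_zero] using this

theorem la_main (H : ι → ι → ℝ) (hsymm : ∀ i j, H i j = H j i) (hoff : ∀ i j, i ≠ j → 0 ≤ H i j)
    (p : ι → ℝ) (hp : ∀ i, 0 < p i) (h : ι → ℝ) (hh : ∀ i, h i = ∑ j, H i j * p j)
    (hpos : ∀ i, 0 < h i)
    (conn : ∀ z : ι → ℝ, (∀ i j, i ≠ j → 0 < H i j → z i = z j) → ∀ i j, z i = z j)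
    (key : ∀ x : ι → ℝ, ∑ i, x i * ∑ j, H i j * x j ≤ ∑ i, p i * (∑ j, H i j * x j) ^ 2 / h i)
    (x : ι → ℝ) (hx : ∑ i, x i * h i = 0) :
    ∑ i, x i * ∑ j, H i j * x j ≤ 0 := by
  set d : ι → ℝ := fun i => Real.sqrt (p i / h i) with hd
  have hdpos : ∀ i, 0 < d i := fun i => Real.sqrt_pos.2 (div_pos (hp i) (hpos i))
  have hd2 : ∀ i, d i * d i = p i / h i := fun i =>
    Real.mul_self_sqrt (div_pos (hp i) (hpos i)).le
  let S : Matrix ι ι ℝ := fun i j => d i * H i j * d j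
  have hS : S.IsHermitian := by
    ext i j
    show star (d j * H j i * d i) = d i * H i j * d j
    rw [star_trivial, hsymm j i]; ring
  have hT := Matrix.isSymmetric_toEuclideanLin_iff.2 hS
  set T := Matrix.toEuclideanLin S with hTdef
  have hTa : ∀ (y : EuclideanSpace ℝ ι) i, T y i = d i * ∑ j, H i j * (d j * y j) := by
    intro y i
    rw [hTdef, Matrix.toLpLin_apply]
    simp only [Matrix.mulVec, dotProduct, S, Finset.mul_sum]
    refine Finset.sum_congr rfl fun j _ => ?_
    ring
  let e := hT.eigenvectorBasis rfl
  let ev := hT.eigenvalues rfl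
  let y : EuclideanSpace ℝ ι := WithLp.toLp 2 fun i => x i / d i
  have hy : ∀ i, d i * y i = x i := fun i => by
    simp only [y]; have := (hdpos i).ne'; field_simp
  have hkey : inner ℝ (T y) y = ∑ i, x i * ∑ j, H i j * x j := by
    rw [PiLp.inner_apply]
    refine Finset.sum_congr rfl fun i _ => ?_
    rw [hTa]; simp only [hy, RCLike.inner_apply, conj_trivial]
    rw [← mul_assoc, mul_comm (y i), hy]
  rw [← hkey, ← e.sum_inner_mul_inner]
  refine Finset.sum_nonpos fun k _ => ?_
  have h1 : inner ℝ (T y) (e k) = ev k * inner ℝ y (e k) := by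
    rw [hT y (e k), hT.apply_eigenvectorBasis rfl k]
    simp only [inner_smul_right]; rfl
  rw [h1, real_inner_comm (e k) y]
  rcases le_or_gt (ev k) 0 with hle | hgt
  · have : 0 ≤ inner ℝ y (e k) * inner ℝ y (e k) := mul_self_nonneg _
    rw [real_inner_comm]
    nlinarith [mul_self_nonneg (inner ℝ (e k) y)]
  · have hev : ∀ i, T (e k) i = ev k * e k i := by
      intro i
      rw [hT.apply_eigenvectorBasis rfl k]; rfl
    have := la_eig H hsymm hoff p hp h hh hpos conn key (fun i => d i * e k i) (ev k) hgt (by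
      intro i
      have h3 := hev i
      rw [hTa] at h3
      have h4 : d i * (d i * ∑ j, H i j * (d j * e k j)) = ev k * (d i * e k i) := by
        rw [h3]; ring
      rw [← mul_assoc, hd2] at h4
      have h5 := (hp i).ne'
      have h6 := (hpos i).ne'
      field_simp at h4 ⊢
      linarith)
    have h0 : inner ℝ (e k) y = 0 := by
      rw [PiLp.inner_apply]
      simp only [RCLike.inner_apply, conj_trivial]
      rcases isEmpty_or_nonempty ι with hem | ⟨⟨i0⟩⟩
      · simp
      · have h7 : ∀ i, y i * e k i = (d i0 * e k i0 / p i0) * (x i * h i) := by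
          intro i
          have h8 := this i0 i
          simp only at h8
          rw [h8]
          have h9 : e k i = (d i * e k i) / d i := by
            have := (hdpos i).ne'; field_simp
          have h10 := (hdpos i).ne'
          have h5 := (hp i).ne'
          have h6 := (hpos i).ne'
          have h11 : y i = x i / d i := rfl
          have h12 := hd2 i
          rw [h11]
          field_simp at h12 ⊢
          rw [← h12]
        simp only [h7, ← Finset.mul_sum, hx, mul_zero]
    rw [h0]; simp

end LA

/-- Discriminant lemma. -/
theorem disc_lemma {a b c t : ℝ} (hc : 0 < c) (h : a - 2 * t * b + t ^ 2 * c ≤ 0) :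
    a * c ≤ b ^ 2 := by
  nlinarith [sq_nonneg (b - t * c), mul_le_mul_of_nonneg_right h hc.le]

end RW


namespace RW
namespace Cx
variable {V : Type*} [Fintype V] [DecidableEq V] {C : Cx V}

/-- Connectivity of links. -/
def Conn (C : Cx V) : Prop :=
  ∀ ⦃τ⦄, C.Face τ → τ.card + 3 ≤ C.N → ∀ z : V → ℝ,
    (∀ G ∈ C.lk τ, ∀ H ∈ C.lk τ, C.adj G H → z G = z H) →
    ∀ G ∈ C.lk τ, ∀ H ∈ C.lk τ, z G = z H

/-- The Hodge-Riemann type inequality. -/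
def HR (C : Cx V) (vs : List (V → ℝ)) (τ : Finset V) : Prop :=
  ∀ x v : V → ℝ, C.Ample v →
    C.Phi (x :: x :: vs) τ * C.Phi (v :: v :: vs) τ ≤ C.Phi (x :: v :: vs) τ ^ 2

theorem Phi_sub (y z : V → ℝ) (ys : List (V → ℝ)) (τ : Finset V) (t : ℝ) :
    C.Phi ((y - t • z) :: ys) τ = C.Phi (y :: ys) τ - t * C.Phi (z :: ys) τ := by
  have : y - t • z = y + (-t) • z := by rw [neg_smul, sub_eq_add_neg]
  rw [this, Phi_add, Phi_smul]; ring

theorem Phi_quad (hC : C.Balanced) {τ : Finset V} {vs : List (V → ℝ)} (hτ : C.Face τ)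
    (hc : τ.card + vs.length + 2 = C.N) (x v : V → ℝ) (t : ℝ) :
    C.Phi ((x - t • v) :: (x - t • v) :: vs) τ =
      C.Phi (x :: x :: vs) τ - 2 * t * C.Phi (x :: v :: vs) τ + t ^ 2 * C.Phi (v :: v :: vs) τ := by
  rw [Phi_sub, Phi_swap hC hτ hc x, Phi_swap hC hτ hc v, Phi_sub, Phi_sub,
    Phi_swap hC hτ hc v x]; ring

theorem HR_of (hC : C.Balanced) {τ : Finset V} {vs : List (V → ℝ)} (hτ : C.Face τ)
    (hc : τ.card + vs.length + 2 = C.N) (hvs : ∀ v ∈ vs, C.Ample v)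
    (x v : V → ℝ) (hv : C.Ample v) (t : ℝ)
    (h : C.Phi ((x - t • v) :: (x - t • v) :: vs) τ ≤ 0) :
    C.Phi (x :: x :: vs) τ * C.Phi (v :: v :: vs) τ ≤ C.Phi (x :: v :: vs) τ ^ 2 := by
  rw [Phi_quad hC hτ hc] at h
  refine disc_lemma (Phi_pos hC _ ?_ hτ ?_) h
  · intro w hw
    simp only [List.mem_cons] at hw
    rcases hw with rfl | rfl | hw
    · exact hv
    · exact hv
    · exact hvs w hw
  · simp only [List.length_cons]; omega

theorem HR_step (hC : C.Balanced) (hconn : C.Conn) {τ : Finset V} {vs : List (V → ℝ)}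
    (hτ : C.Face τ) {u : V → ℝ} (hc : τ.card + vs.length + 3 = C.N)
    (hvs : ∀ v ∈ vs, C.Ample v) (hu : C.Ample u)
    (ih : ∀ G ∈ C.lk τ, C.HR vs (insert G τ)) : C.HR (u :: vs) τ := by
  have : ∀ G H, Decidable (C.adj G H) := fun _ _ => Classical.dec _
  obtain ⟨l, hl, hl1, hl2⟩ := hu hτ
  have hcu : τ.card + (u :: vs).length + 2 = C.N := by simp only [List.length_cons]; omega
  have amp2 : ∀ w ∈ u :: vs, C.Ample w := by
    intro w hw
    rcases List.mem_cons.1 hw with rfl | hw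
    · exact hu
    · exact hvs w hw
  have amp3 : ∀ w ∈ u :: u :: vs, C.Ample w := by
    intro w hw
    rcases List.mem_cons.1 hw with rfl | hw
    · exact hu
    · exact amp2 w hw
  -- reduction to orthogonal complement of `u`
  have main : ∀ x : V → ℝ, C.Phi (u :: x :: u :: vs) τ = 0 → C.Phi (x :: x :: u :: vs) τ ≤ 0 := by
    intro x hx0
    -- coordinates
    let X : (V → ℝ) → (C.lk τ) → ℝ := fun y G => (y - C.ip τ y) G
    let Hm : (C.lk τ) → (C.lk τ) → ℝ := fun G H =>
      (if C.adj G.1 H.1 then C.Phi (u :: vs) (insert H.1 (insert G.1 τ)) else 0)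
        - (if G = H then C.dg (u :: vs) τ G.1 else 0)
    have hrow : ∀ (y : V → ℝ) (G : C.lk τ),
        C.Phi (y :: u :: vs) (insert G.1 τ) = ∑ H, Hm G H * X y H := by
      intro y G
      rw [Phi_ins' hC hτ hcu y G.2]
      simp only [Hm, sub_mul, Finset.sum_sub_distrib, ite_mul, zero_mul, Finset.sum_ite_eq,
        Finset.mem_univ, if_true]
      congr 1
      · rw [Finset.sum_coe_sort (C.lk τ) (fun H => if C.adj G.1 H then
          C.Phi (u :: vs) (insert H (insert G.1 τ)) * (y - C.ip τ y) H else 0),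
          ← Finset.sum_filter]
        refine Finset.sum_congr ?_ fun H _ => mul_comm _ _
        ext H
        rw [mem_lk_insert, Finset.mem_filter, and_comm]
      · exact mul_comm _ _
    have hform : ∀ y z : V → ℝ, C.Phi (y :: z :: u :: vs) τ = ∑ G, X y G * ∑ H, Hm G H * X z H := by
      intro y z
      rw [Phi_cons, ← Finset.sum_coe_sort]
      refine Finset.sum_congr rfl fun G _ => ?_
      rw [← hrow]; rfl
    let p : C.lk τ → ℝ := fun G => u G.1 - l G.1
    have hp : ∀ G, 0 < p G := fun G => hl2 G.1 G.2
    -- `p` is represented by `u - l`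
    have hXul : ∀ G, X (u - l) G = p G := by
      intro G
      have : C.ip τ (u - l) = 0 := by
        ext H
        simp only [ip, Pi.zero_apply]
        refine Finset.sum_eq_zero fun F hF => ?_
        rw [Pi.sub_apply, hl1 F hF]; ring
      simp only [X, this, p, Pi.sub_apply, Pi.zero_apply, sub_zero]
    have hul : ∀ (y : V → ℝ) (ys : List (V → ℝ)) (σ : Finset V), C.Face σ →
        σ.card + ys.length + 1 = C.N → C.Phi ((y - l) :: ys) σ = C.Phi (y :: ys) σ := by
      intro y ys σ hσ hcs
      rw [Phi_eq hC hσ hcs (y - l) (C.ip σ y - l) (Submodule.sub_mem _ (ip_mem hσ y) hl)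
        (fun F hF => by simp [ip_eq hσ y hF]), Phi_cons]
      refine Finset.sum_congr rfl fun G _ => ?_
      simp only [Pi.sub_apply]; ring
    have hface : ∀ G : C.lk τ, C.Face (insert G.1 τ) := fun G => face_ins hτ G.2
    have hcard : ∀ G : C.lk τ, (insert G.1 τ).card = τ.card + 1 := fun G => card_ins G.2
    have hh : ∀ G : C.lk τ, C.Phi (u :: u :: vs) (insert G.1 τ) = ∑ H, Hm G H * p H := by
      intro G
      rw [← hul u (u :: vs) _ (hface G) (by rw [hcard]; simp only [List.length_cons]; omega),
        hrow]
      simp only [hXul]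
    have hpos : ∀ G : C.lk τ, 0 < C.Phi (u :: u :: vs) (insert G.1 τ) := fun G =>
      Phi_pos hC _ amp3 (hface G) (by rw [hcard]; simp only [List.length_cons]; omega)
    have hoffpos : ∀ G H : C.lk τ, C.adj G.1 H.1 →
        0 < C.Phi (u :: vs) (insert H.1 (insert G.1 τ)) := by
      intro G H hGH
      have hH : H.1 ∈ C.lk (insert G.1 τ) := mem_lk_insert.2 ⟨hGH, H.2⟩
      refine Phi_pos hC _ amp2 (face_ins (hface G) hH) ?_
      rw [card_ins hH, hcard]; simp only [List.length_cons]; omega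
    have hsymm : ∀ G H, Hm G H = Hm H G := by
      intro G H
      simp only [Hm]
      have e1 : C.adj G.1 H.1 ↔ C.adj H.1 G.1 := ⟨fun h => C.adj_symm h, fun h => C.adj_symm h⟩
      rw [Finset.insert_comm]
      congr 1
      · simp only [e1]
      · by_cases h : G = H
        · subst h; rfl
        · rw [if_neg h, if_neg (Ne.symm h)]
    have hoff : ∀ G H, G ≠ H → 0 ≤ Hm G H := by
      intro G H h
      simp only [Hm, if_neg h, sub_zero]
      split_ifs with h2
      · exact (hoffpos G H h2).le
      · exact le_rfl
    have hconn' : ∀ z : C.lk τ → ℝ, (∀ i j, i ≠ j → 0 < Hm i j → z i = z j) →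
        ∀ i j, z i = z j := by
      intro z hz i j
      have := hconn hτ (by omega) (fun G => if h : G ∈ C.lk τ then z ⟨G, h⟩ else 0) (by
        intro G hG H hH hGH
        simp only [dif_pos hG, dif_pos hH]
        have hne : (⟨G, hG⟩ : C.lk τ) ≠ ⟨H, hH⟩ := by
          intro h
          have h' : G = H := congrArg Subtype.val h
          subst h'
          exact C.adj_irrefl _ hGH
        refine hz _ _ hne ?_
        simp only [Hm, if_neg hne, sub_zero, if_pos hGH]
        exact hoffpos ⟨G, hG⟩ ⟨H, hH⟩ hGH) i.1 i.2 j.1 j.2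
      simpa using this
    -- extension of vectors on the link
    let ext : (C.lk τ → ℝ) → V → ℝ := fun y G => if h : G ∈ C.lk τ then y ⟨G, h⟩ else 0
    have hext : ∀ y G, X (ext y) G = y G := by
      intro y G
      have : C.ip τ (ext y) = 0 := by
        ext H
        simp only [ip, Pi.zero_apply]
        refine Finset.sum_eq_zero fun F hF => ?_
        have : F ∉ C.lk τ := fun h => not_mem_of_mem_lk h hF
        simp [ext, this]
      simp [X, this, ext]
    have key : ∀ y : C.lk τ → ℝ, ∑ i, y i * ∑ j, Hm i j * y j ≤
        ∑ i, p i * (∑ j, Hm i j * y j) ^ 2 / C.Phi (u :: u :: vs) (insert i.1 τ) := by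
      intro y
      have h1 := hform (ext y) (ext y)
      simp only [hext] at h1
      rw [← h1, Phi_perm hC (List.perm_iff_count.2 (by
        intro a; simp only [List.count_cons]; ring) :
          (ext y :: ext y :: u :: vs).Perm (u :: ext y :: ext y :: vs)) hτ
          (by simp only [List.length_cons]; omega),
        Phi_eq hC hτ (by simp only [List.length_cons]; omega) u l hl hl1, ← Finset.sum_coe_sort]
      refine Finset.sum_le_sum fun G _ => ?_
      have h2 := ih G.1 G.2 (ext y) u hu
      have h3 := hrow (ext y) G
      simp only [hext] at h3
      rw [h3] at h2
      rw [mul_div_assoc]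
      refine mul_le_mul_of_nonneg_left ?_ (hp G).le
      rw [le_div_iff₀ (hpos G)]
      exact h2
    rw [hform]
    refine la_main Hm hsymm hoff p hp (fun G => C.Phi (u :: u :: vs) (insert G.1 τ)) hh hpos hconn'
      key (X x) ?_
    rw [Phi_swap hC hτ hcu, ← Phi_swap hC hτ hcu,
      ← hul u _ τ hτ (by simp only [List.length_cons]; omega), Phi_swap hC hτ hcu, hform] at hx0
    simp only [hXul] at hx0
    simpa only [hh] using hx0
  intro x v hv
  have hvu : 0 < C.Phi (v :: u :: u :: vs) τ := by
    refine Phi_pos hC _ ?_ hτ (by simp only [List.length_cons]; omega)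
    intro w hw
    rcases List.mem_cons.1 hw with rfl | hw
    · exact hv
    · exact amp3 w hw
  refine HR_of hC hτ hcu amp2 x v hv
    (C.Phi (x :: u :: u :: vs) τ / C.Phi (v :: u :: u :: vs) τ) (main _ ?_)
  rw [Phi_swap hC hτ hcu, Phi_sub, div_mul_cancel₀ _ hvu.ne', sub_self]

theorem HR_all (hC : C.Balanced) (hconn : C.Conn)
    (hbase : ∀ τ, C.Face τ → τ.card + 2 = C.N → C.HR [] τ) (vs : List (V → ℝ)) :
    (∀ v ∈ vs, C.Ample v) → ∀ {τ : Finset V}, C.Face τ → τ.card + vs.length + 2 = C.N →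
    C.HR vs τ := by
  induction vs with
  | nil => intro _ τ hτ hc; exact hbase τ hτ (by simpa using hc)
  | cons u vs ih =>
    intro hv τ hτ hc
    simp only [List.length_cons] at hc
    refine HR_step hC hconn hτ (by omega) (fun v h => hv v (by simp [h])) (hv u (by simp)) ?_
    intro G hG
    exact ih (fun v h => hv v (by simp [h])) (face_ins hτ hG) (by rw [card_ins hG]; omega)

/-- Log-concavity for nef classes. -/
theorem HR_nef (hC : C.Balanced) (hconn : C.Conn)
    (hbase : ∀ τ, C.Face τ → τ.card + 2 = C.N → C.HR [] τ) (vs : List (V → ℝ))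
    (hvs : ∀ v ∈ vs, C.Nef v) {x y s : V → ℝ} (hy : C.Nef y) (hs : C.Ample s)
    {τ : Finset V} (hτ : C.Face τ) (hc : τ.card + vs.length + 2 = C.N) :
    C.Phi (x :: x :: vs) τ * C.Phi (y :: y :: vs) τ ≤ C.Phi (x :: y :: vs) τ ^ 2 := by
  let sh : (V → ℝ) → ℝ → V → ℝ := fun v e => v + e • s
  have hsh : ∀ v, Continuous (sh v) := fun v => by
    simp only [sh]; fun_prop
  have cont : ∀ ws : List (V → ℝ), Continuous fun e : ℝ => C.Phi (ws.map fun v => sh v e) τ := by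
    intro ws
    have := Phi_continuous (C := C) (ws.map sh) (by
      intro f hf
      obtain ⟨v, _, rfl⟩ := List.mem_map.1 hf
      exact hsh v) τ
    simpa [List.map_map, Function.comp_def] using this
  have c1 := cont (x :: x :: vs)
  have c2 := cont (y :: y :: vs)
  have c3 := cont (x :: y :: vs)
  have z : ∀ ws : List (V → ℝ), ws.map (fun v => sh v 0) = ws := by
    intro ws; simp [sh]
  have t1 : Filter.Tendsto (fun e : ℝ => C.Phi ((x :: x :: vs).map fun v => sh v e) τ *
      C.Phi ((y :: y :: vs).map fun v => sh v e) τ) (nhdsWithin 0 (Set.Ioi 0))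
      (nhds (C.Phi (x :: x :: vs) τ * C.Phi (y :: y :: vs) τ)) := by
    have := ((c1.mul c2).tendsto 0).mono_left (nhdsWithin_le_nhds (s := Set.Ioi (0:ℝ)))
    rwa [Pi.mul_apply, z, z] at this
  have t2 : Filter.Tendsto (fun e : ℝ => C.Phi ((x :: y :: vs).map fun v => sh v e) τ ^ 2)
      (nhdsWithin 0 (Set.Ioi 0)) (nhds (C.Phi (x :: y :: vs) τ ^ 2)) := by
    have := ((c3.pow 2).tendsto 0).mono_left (nhdsWithin_le_nhds (s := Set.Ioi (0:ℝ)))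
    rwa [Pi.pow_apply, z] at this
  refine le_of_tendsto_of_tendsto t1 t2 ?_
  filter_upwards [self_mem_nhdsWithin] with e he
  simp only [List.map_cons]
  refine HR_all hC hconn hbase (vs.map fun v => sh v e) ?_ hτ (by simpa using hc) _ _
    (hy.add_ample hs he)
  intro v hv
  obtain ⟨w, hw, rfl⟩ := List.mem_map.1 hv
  exact (hvs w hw).add_ample hs he

end Cx
end RW


namespace FinMatroid

variable {E : Type*} [Fintype E] [DecidableEq E] {M : FinMatroid E}

theorem card_le_rank {I A : Finset E} (hI : M.Indep I) (h : I ⊆ A) : I.card ≤ M.rank A := by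
  classical
  unfold rank
  exact Finset.le_sup (f := Finset.card) (by simp [hI, h])

theorem exists_card_eq_rank (M : FinMatroid E) (A : Finset E) :
    ∃ J, M.Indep J ∧ J ⊆ A ∧ J.card = M.rank A := by
  classical
  have hne : (A.powerset.filter fun I => M.Indep I).Nonempty :=
    ⟨∅, by simp [M.indep_empty]⟩
  obtain ⟨J, hJ, h⟩ := Finset.exists_mem_eq_sup _ hne Finset.card
  simp only [Finset.mem_filter, Finset.mem_powerset] at hJ
  exact ⟨J, hJ.2, hJ.1, by unfold rank; rw [h]⟩

theorem exists_basis {I A : Finset E} (hI : M.Indep I) (h : I ⊆ A) :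
    ∃ J, M.Indep J ∧ I ⊆ J ∧ J ⊆ A ∧ J.card = M.rank A := by
  obtain ⟨K, hK, hKA, hKc⟩ := M.exists_card_eq_rank A
  have : ∀ n, ∀ I, M.Indep I → I ⊆ A → M.rank A - I.card = n →
      ∃ J, M.Indep J ∧ I ⊆ J ∧ J ⊆ A ∧ J.card = M.rank A := by
    intro n
    induction n with
    | zero =>
      intro I hI h hn
      exact ⟨I, hI, subset_rfl, h, le_antisymm (card_le_rank hI h) (by omega)⟩
    | succ n ih =>
      intro I hI h hn
      obtain ⟨e, heK, heI, hins⟩ := M.indep_exchange hI hK (by omega)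
      obtain ⟨J, h1, h2, h3, h4⟩ := ih (insert e I) hins
        (Finset.insert_subset (hKA heK) h) (by rw [Finset.card_insert_of_notMem heI]; omega)
      exact ⟨J, h1, (Finset.subset_insert _ _).trans h2, h3, h4⟩
  exact this _ I hI h rfl

theorem rank_mono {A B : Finset E} (h : A ⊆ B) : M.rank A ≤ M.rank B := by
  obtain ⟨J, h1, h2, h3⟩ := M.exists_card_eq_rank A
  rw [← h3]; exact card_le_rank h1 (h2.trans h)

theorem rank_insert_le (x : E) (A : Finset E) : M.rank (insert x A) ≤ M.rank A + 1 := by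
  obtain ⟨J, h1, h2, h3⟩ := M.exists_card_eq_rank (insert x A)
  have : (J.erase x).card ≤ M.rank A := card_le_rank (M.indep_subset h1 (Finset.erase_subset _ _))
    (by rw [← Finset.subset_insert_iff]; exact h2)
  have := Finset.pred_card_le_card_erase (s := J) (a := x)
  omega

theorem rank_insert_of_subset {A B : Finset E} (hAB : A ⊆ B) {x : E}
    (h : M.rank (insert x A) = M.rank A) : M.rank (insert x B) = M.rank B := by
  refine le_antisymm ?_ (rank_mono (Finset.subset_insert _ _))
  by_contra hlt
  push Not at hlt
  obtain ⟨I, hI, hIA, hIc⟩ := M.exists_card_eq_rank A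
  obtain ⟨J, hJ, hIJ, hJB, hJc⟩ := exists_basis hI (hIA.trans hAB)
  obtain ⟨K, hK, hJK, hKB, hKc⟩ := exists_basis hJ (hJB.trans (Finset.subset_insert x B))
  have hxK : x ∈ K := by
    by_contra hx
    have : K ⊆ B := by
      intro y hy
      rcases Finset.mem_insert.1 (hKB hy) with rfl | h'
      · exact absurd hy hx
      · exact h'
    have := card_le_rank hK this
    omega
  have hxI : x ∉ I := by
    intro hx
    have : x ∈ B := hAB (hIA hx)
    rw [Finset.insert_eq_of_mem this] at hlt
    omega
  have := card_le_rank (M.indep_subset hK (Finset.insert_subset hxK (hIJ.trans hJK)))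
    (Finset.insert_subset_insert x hIA)
  rw [Finset.card_insert_of_notMem hxI] at this
  omega

theorem mem_closure {A : Finset E} {x : E} :
    x ∈ M.closure A ↔ M.rank (insert x A) = M.rank A := by simp [closure]

theorem subset_closure (A : Finset E) : A ⊆ M.closure A := by
  intro x hx
  rw [mem_closure, Finset.insert_eq_of_mem hx]

theorem closure_mono {A B : Finset E} (h : A ⊆ B) : M.closure A ⊆ M.closure B := by
  intro x hx
  rw [mem_closure] at hx ⊢
  exact rank_insert_of_subset h hx

theorem rank_union_of_subset_closure {A B : Finset E} (h : B ⊆ M.closure A) :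
    M.rank (B ∪ A) = M.rank A := by
  induction B using Finset.induction_on with
  | empty => simp
  | insert x B hx ih =>
    rw [Finset.insert_subset_iff] at h
    rw [Finset.insert_union, rank_insert_of_subset Finset.subset_union_right (mem_closure.1 h.1),
      ih h.2]

theorem rank_closure (A : Finset E) : M.rank (M.closure A) = M.rank A := by
  have := rank_union_of_subset_closure (M := M) (A := A) (B := M.closure A) subset_rfl
  rwa [Finset.union_eq_left.2 (subset_closure A)] at this

theorem isFlat_closure (A : Finset E) : M.IsFlat (M.closure A) := by
  refine le_antisymm ?_ (subset_closure _)
  intro x hx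
  rw [mem_closure, rank_closure] at hx
  rw [mem_closure]
  refine le_antisymm ?_ (rank_mono (Finset.subset_insert _ _))
  rw [← hx]
  exact rank_mono (Finset.insert_subset_insert x (subset_closure A))

theorem closure_subset_of_flat {A F : Finset E} (hF : M.IsFlat F) (h : A ⊆ F) :
    M.closure A ⊆ F := by
  have := closure_mono (M := M) h
  rwa [hF] at this

theorem isFlat_univ : M.IsFlat Finset.univ :=
  le_antisymm (Finset.subset_univ _) (subset_closure _)

theorem rank_empty : M.rank ∅ = 0 := by
  obtain ⟨J, h1, h2, h3⟩ := M.exists_card_eq_rank ∅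
  rw [← h3, Finset.subset_empty.1 h2, Finset.card_empty]

theorem rank_insert_flat {F : Finset E} (hF : M.IsFlat F) {x : E} (hx : x ∉ F) :
    M.rank (insert x F) = M.rank F + 1 := by
  refine le_antisymm (rank_insert_le x F) ?_
  have h1 : M.rank F ≤ M.rank (insert x F) := rank_mono (Finset.subset_insert _ _)
  have : M.rank (insert x F) ≠ M.rank F := by
    rw [← hF] at hx
    rwa [Ne, ← mem_closure]
  omega

theorem rank_lt {F G : Finset E} (hF : M.IsFlat F) (h : F ⊂ G) : M.rank F < M.rank G := by
  obtain ⟨x, hxG, hxF⟩ := Finset.exists_of_ssubset h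
  have := rank_insert_flat hF hxF
  have : M.rank (insert x F) ≤ M.rank G := rank_mono (Finset.insert_subset hxG h.1)
  omega

/-- The flat spanned by `F` and `x`. -/
noncomputable def ad (M : FinMatroid E) (F : Finset E) (x : E) : Finset E := M.closure (insert x F)

theorem ad_flat (F : Finset E) (x : E) : M.IsFlat (M.ad F x) := isFlat_closure _

theorem subset_ad (F : Finset E) (x : E) : F ⊆ M.ad F x :=
  (Finset.subset_insert _ _).trans (subset_closure _)

theorem mem_ad (F : Finset E) (x : E) : x ∈ M.ad F x :=
  subset_closure _ (Finset.mem_insert_self _ _)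

theorem ssubset_ad {F : Finset E} {x : E} (hx : x ∉ F) : F ⊂ M.ad F x :=
  Finset.ssubset_iff_subset_ne.2 ⟨subset_ad F x, fun h => hx (h ▸ mem_ad F x)⟩

theorem rank_ad {F : Finset E} (hF : M.IsFlat F) {x : E} (hx : x ∉ F) :
    M.rank (M.ad F x) = M.rank F + 1 := by
  rw [ad, rank_closure, rank_insert_flat hF hx]

theorem ad_subset {F G : Finset E} (hG : M.IsFlat G) {x : E} (hx : x ∈ G) (h : F ⊆ G) :
    M.ad F x ⊆ G := closure_subset_of_flat hG (Finset.insert_subset hx h)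

theorem flat_eq_of_subset {F G : Finset E} (hF : M.IsFlat F) (h : F ⊆ G)
    (hr : M.rank G ≤ M.rank F) : F = G := by
  by_contra hne
  have := rank_lt hF (Finset.ssubset_iff_subset_ne.2 ⟨h, hne⟩)
  omega

theorem eq_ad {F G : Finset E} (hF : M.IsFlat F) (hG : M.IsFlat G) (h : F ⊆ G)
    (hr : M.rank G = M.rank F + 1) {x : E} (hx : x ∈ G) (hxF : x ∉ F) : M.ad F x = G :=
  flat_eq_of_subset (ad_flat F x) (ad_subset hG hx h) (by rw [rank_ad hF hxF, hr])

/-- The covers of `F` below `K`. -/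
noncomputable def cov (M : FinMatroid E) (F K : Finset E) : Finset (Finset E) :=
  M.flats.filter fun G => F ⊆ G ∧ G ⊆ K ∧ M.rank G = M.rank F + 1

theorem mem_flats {F : Finset E} : F ∈ M.flats ↔ M.IsFlat F := by simp [flats]

theorem mem_cov {F K G : Finset E} :
    G ∈ M.cov F K ↔ M.IsFlat G ∧ F ⊆ G ∧ G ⊆ K ∧ M.rank G = M.rank F + 1 := by
  simp [cov, mem_flats]

theorem sum_cov {R : Type*} [AddCommMonoid R] {F K : Finset E} (hF : M.IsFlat F) (hK : M.IsFlat K)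
    (hFK : F ⊆ K) (a : E → R) :
    ∑ G ∈ M.cov F K, ∑ i ∈ G \ F, a i = ∑ i ∈ K \ F, a i := by
  rw [← Finset.sum_biUnion]
  · refine Finset.sum_congr ?_ fun _ _ => rfl
    ext x
    simp only [Finset.mem_biUnion, Finset.mem_sdiff, mem_cov]
    constructor
    · rintro ⟨G, ⟨_, _, h, _⟩, hx, hxF⟩
      exact ⟨h hx, hxF⟩
    · rintro ⟨hx, hxF⟩
      exact ⟨M.ad F x, ⟨ad_flat F x, subset_ad F x, ad_subset hK hx hFK, rank_ad hF hxF⟩,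
        mem_ad F x, hxF⟩
  · intro G hG G' hG' hne
    simp only [Finset.mem_coe, mem_cov] at hG hG'
    rw [Function.onFun, Finset.disjoint_left]
    intro x hx hx'
    simp only [Finset.mem_sdiff] at hx hx'
    exact hne ((eq_ad hF hG.1 hG.2.1 hG.2.2.2 hx.1 hx.2).symm.trans
      (eq_ad hF hG'.1 hG'.2.1 hG'.2.2.2 hx'.1 hx.2))

end FinMatroid


namespace FinMatroid

variable {E : Type*} [Fintype E] [DecidableEq E] {M : FinMatroid E}

/-- Comparability of distinct flats. -/
def fadj (M : FinMatroid E) (F G : Finset E) : Prop :=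
  M.IsFlat F ∧ M.IsFlat G ∧ (F ⊂ G ∨ G ⊂ F)

/-- Chains of flats containing the bottom and top. -/
def FFace (M : FinMatroid E) (τ : Finset (Finset E)) : Prop :=
  ∅ ∈ τ ∧ Finset.univ ∈ τ ∧ (∀ F ∈ τ, M.IsFlat F) ∧ ∀ F ∈ τ, ∀ G ∈ τ, F ⊆ G ∨ G ⊆ F

/-- Affine functions on subsets. -/
def affW (E : Type*) [Fintype E] [DecidableEq E] : Submodule ℝ (Finset E → ℝ) where
  carrier := {l | ∃ (a0 : ℝ) (a : E → ℝ), ∀ S, l S = a0 + ∑ i ∈ S, a i}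
  add_mem' := by
    rintro l m ⟨a0, a, h⟩ ⟨b0, b, h'⟩
    refine ⟨a0 + b0, a + b, fun S => ?_⟩
    simp only [Pi.add_apply, h, h', Finset.sum_add_distrib]; ring
  zero_mem' := ⟨0, 0, fun S => by simp⟩
  smul_mem' := by
    rintro c l ⟨a0, a, h⟩
    refine ⟨c * a0, c • a, fun S => ?_⟩
    simp only [Pi.smul_apply, h, smul_eq_mul, ← Finset.mul_sum]; ring

theorem mem_affW {l : Finset E → ℝ} :
    l ∈ affW E ↔ ∃ (a0 : ℝ) (a : E → ℝ), ∀ S, l S = a0 + ∑ i ∈ S, a i := Iff.rfl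

theorem const_mem (c : ℝ) : (fun _ => c) ∈ affW E := ⟨c, 0, fun S => by simp⟩

theorem ind_mem (i : E) : (fun S : Finset E => if i ∈ S then (1:ℝ) else 0) ∈ affW E :=
  ⟨0, fun j => if i = j then 1 else 0, fun S => by simp⟩

theorem aff_sub {l : Finset E → ℝ} (hl : l ∈ affW E) :
    ∃ a : E → ℝ, ∀ S T : Finset E, S ⊆ T → l T - l S = ∑ i ∈ T \ S, a i := by
  obtain ⟨a0, a, h⟩ := hl
  refine ⟨a, fun S T hST => ?_⟩
  rw [h, h, ← Finset.sum_sdiff hST]; ring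

theorem aff_cov {l : Finset E → ℝ} (hl : l ∈ affW E) {F K : Finset E} (hF : M.IsFlat F)
    (hK : M.IsFlat K) (hFK : F ⊆ K) : ∑ G ∈ M.cov F K, (l G - l F) = l K - l F := by
  obtain ⟨a, ha⟩ := aff_sub hl
  rw [ha F K hFK, ← sum_cov hF hK hFK]
  exact Finset.sum_congr rfl fun G hG => ha F G (mem_cov.1 hG).2.1

theorem exists_pred {τ : Finset (Finset E)} (hτ : M.FFace τ) {X : Finset E} (hX : X.Nonempty) :
    ∃ P ∈ τ, P ⊂ X ∧ ∀ H ∈ τ, H ⊂ X → H ⊆ P := by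
  classical
  obtain ⟨P, hP, hmax⟩ := Finset.exists_max_image (τ.filter fun H => H ⊂ X) Finset.card
    ⟨∅, by simp [hτ.1, hX]⟩
  simp only [Finset.mem_filter] at hP hmax
  refine ⟨P, hP.1, hP.2, fun H hH hHX => ?_⟩
  rcases hτ.2.2.2 H hH P hP.1 with h | h
  · exact h
  · exact (Finset.eq_of_subset_of_card_le h (hmax H ⟨hH, hHX⟩)).symm.subset

theorem exists_succ {τ : Finset (Finset E)} (hτ : M.FFace τ) {X : Finset E}
    (hX : X ≠ Finset.univ) :
    ∃ P ∈ τ, X ⊂ P ∧ ∀ H ∈ τ, X ⊂ H → P ⊆ H := by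
  classical
  obtain ⟨P, hP, hmax⟩ := Finset.exists_min_image (τ.filter fun H => X ⊂ H) Finset.card
    ⟨Finset.univ, by simp [hτ.2.1, Finset.ssubset_univ_iff, hX]⟩
  simp only [Finset.mem_filter] at hP hmax
  refine ⟨P, hP.1, hP.2, fun H hH hHX => ?_⟩
  rcases hτ.2.2.2 H hH P hP.1 with h | h
  · exact (Finset.eq_of_subset_of_card_le h (hmax H ⟨hH, hHX⟩)).symm.subset
  · exact h

theorem exists_up {τ : Finset (Finset E)} (hτ : M.FFace τ) {F : Finset E} (hF : F ∈ τ) :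
    ∃ u ∈ affW E, ∀ H ∈ τ, u H = if F ⊆ H then 1 else 0 := by
  rcases F.eq_empty_or_nonempty with rfl | hne
  · exact ⟨fun _ => 1, const_mem 1, fun H _ => by simp⟩
  · obtain ⟨P, hP, hPF, hmax⟩ := exists_pred hτ hne
    obtain ⟨i, hiF, hiP⟩ := Finset.exists_of_ssubset hPF
    refine ⟨_, ind_mem i, fun H hH => ?_⟩
    by_cases h : F ⊆ H
    · simp [h, h hiF]
    · have h1 : H ⊂ F := by
        rcases hτ.2.2.2 F hF H hH with h' | h'
        · exact absurd h' h
        · exact ⟨h', h⟩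
      have : i ∉ H := fun hi => hiP (hmax H hH h1 hi)
      simp [h, this]

theorem exists_dual {τ : Finset (Finset E)} {F : Finset E} (hτ : M.FFace τ) (hF : F ∈ τ) :
    ∃ l ∈ affW E, l F = 1 ∧ ∀ F' ∈ τ, F' ≠ F → l F' = 0 := by
  obtain ⟨u, hu, hu1⟩ := exists_up hτ hF
  by_cases hFu : F = Finset.univ
  · refine ⟨u, hu, by simp [hu1 F hF], fun H hH hne => ?_⟩
    rw [hu1 H hH, if_neg]
    intro h
    rw [hFu, Finset.univ_subset_iff] at h
    exact hne (h.trans hFu.symm)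
  · obtain ⟨Q, hQ, hFQ, hmin⟩ := exists_succ hτ hFu
    obtain ⟨v, hv, hv1⟩ := exists_up hτ hQ
    refine ⟨u - v, Submodule.sub_mem _ hu hv, ?_, fun H hH hne => ?_⟩
    · simp [hu1 F hF, hv1 F hF, hFQ.2]
    · simp only [Pi.sub_apply, hu1 H hH, hv1 H hH]
      by_cases h : F ⊆ H
      · have : Q ⊆ H := hmin H hH (Finset.ssubset_iff_subset_ne.2 ⟨h, hne.symm⟩)
        simp [h, this]
      · have : ¬ Q ⊆ H := fun h' => h (hFQ.1.trans h')
        simp [h, this]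

/-- Ranks not occurring in the chain. -/
noncomputable def miss (M : FinMatroid E) (τ : Finset (Finset E)) : Finset ℕ :=
  Finset.range (M.rk + 1) \ τ.image M.rank

theorem rank_le_rk (F : Finset E) : M.rank F ≤ M.rk := rank_mono (Finset.subset_univ _)

theorem chain_eq {τ : Finset (Finset E)} (hτ : M.FFace τ) {F G : Finset E} (hF : F ∈ τ)
    (hG : G ∈ τ) (h : M.rank F ≤ M.rank G) : F ⊆ G := by
  rcases hτ.2.2.2 F hF G hG with h' | h'
  · exact h'
  · exact (flat_eq_of_subset (hτ.2.2.1 G hG) h' h).symm.subset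

theorem card_miss {τ : Finset (Finset E)} (hτ : M.FFace τ) :
    (M.miss τ).card + τ.card = M.rk + 1 := by
  have h1 : (τ.image M.rank).card = τ.card := by
    refine Finset.card_image_of_injOn fun F hF G hG h => ?_
    exact (chain_eq hτ hF hG h.le).antisymm (chain_eq hτ hG hF h.ge)
  have h2 : τ.image M.rank ⊆ Finset.range (M.rk + 1) := by
    intro k hk
    obtain ⟨F, _, rfl⟩ := Finset.mem_image.1 hk
    have := rank_le_rk (M := M) F
    simp; omega
  have := Finset.card_sdiff_add_card_eq_card h2
  rw [Finset.card_range, h1] at this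
  exact this

theorem mem_miss {τ : Finset (Finset E)} {k : ℕ} :
    k ∈ M.miss τ ↔ k ≤ M.rk ∧ ∀ F ∈ τ, M.rank F ≠ k := by
  simp [miss, Nat.lt_succ_iff]

theorem exists_gap {τ : Finset (Finset E)} (hτ : M.FFace τ) {k : ℕ} (hk : k ∈ M.miss τ) :
    ∃ P ∈ τ, ∃ Q ∈ τ, P ⊂ Q ∧ M.rank P < k ∧ k < M.rank Q ∧
      ∀ H ∈ τ, (H ⊆ P ∧ M.rank H < k) ∨ (Q ⊆ H ∧ k < M.rank H) := by
  classical
  rw [mem_miss] at hk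
  have h0 : M.rank ∅ < k := by
    have := hk.2 ∅ hτ.1
    rw [rank_empty] at this ⊢; omega
  have h1 : k < M.rank Finset.univ := by
    have := hk.2 _ hτ.2.1
    have : M.rk = M.rank Finset.univ := rfl
    omega
  obtain ⟨P, hP, hmax⟩ := Finset.exists_max_image (τ.filter fun H => M.rank H < k) M.rank
    ⟨∅, by simp [hτ.1, h0]⟩
  obtain ⟨Q, hQ, hmin⟩ := Finset.exists_min_image (τ.filter fun H => k < M.rank H) M.rank
    ⟨Finset.univ, by simp [hτ.2.1, h1]⟩
  simp only [Finset.mem_filter] at hP hmax hQ hmin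
  refine ⟨P, hP.1, Q, hQ.1, ?_, hP.2, hQ.2, fun H hH => ?_⟩
  · refine Finset.ssubset_iff_subset_ne.2 ⟨chain_eq hτ hP.1 hQ.1 (by omega), ?_⟩
    intro h
    rw [h] at hP; omega
  · rcases lt_or_gt_of_ne (hk.2 H hH) with h | h
    · exact Or.inl ⟨chain_eq hτ hH hP.1 (hmax H ⟨hH, h⟩), h⟩
    · exact Or.inr ⟨chain_eq hτ hQ.1 hH (hmin H ⟨hH, h⟩), h⟩

theorem link_of_gap {τ : Finset (Finset E)} (hτ : M.FFace τ) {P Q G : Finset E}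
    (hgap : ∀ H ∈ τ, H ⊆ P ∨ Q ⊆ H) (hG : M.IsFlat G) (h1 : P ⊂ G) (h2 : G ⊂ Q) :
    ∀ F ∈ τ, M.fadj F G := by
  intro F hF
  refine ⟨hτ.2.2.1 F hF, hG, ?_⟩
  rcases hgap F hF with h | h
  · exact Or.inl (lt_of_le_of_lt h h1)
  · exact Or.inr (lt_of_lt_of_le h2 h)

theorem exists_link {τ : Finset (Finset E)} (hτ : M.FFace τ) {P Q : Finset E}
    (hP : P ∈ τ) (hQ : Q ∈ τ) (hPQ : P ⊂ Q)
    (hgap : ∀ H ∈ τ, H ⊆ P ∨ Q ⊆ H) (hr : M.rank P + 1 < M.rank Q) :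
    ∃ G, (∀ F ∈ τ, M.fadj F G) ∧ P ⊂ G ∧ G ⊂ Q := by
  obtain ⟨x, hxQ, hxP⟩ := Finset.exists_of_ssubset hPQ
  have h1 : P ⊂ M.ad P x := ssubset_ad hxP
  have h2 : M.ad P x ⊂ Q := by
    refine Finset.ssubset_iff_subset_ne.2 ⟨ad_subset (hτ.2.2.1 Q hQ) hxQ hPQ.1, fun h => ?_⟩
    have := rank_ad (hτ.2.2.1 P hP) hxP
    rw [h] at this; omega
  exact ⟨_, link_of_gap hτ hgap (ad_flat P x) h1 h2, h1, h2⟩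

/-- The order complex of the lattice of flats. -/
noncomputable def fcx (M : FinMatroid E) : RW.Cx (Finset E) where
  adj := M.fadj
  adj_symm := fun a b h => ⟨h.2.1, h.1, h.2.2.symm⟩
  adj_irrefl := fun a h => by
    rcases h.2.2 with h | h <;> exact (ssubset_irrefl _ h)
  N := M.rk + 1
  Face := M.FFace
  W := affW E
  face_insert := by
    intro τ G hτ hG
    refine ⟨Finset.mem_insert_of_mem hτ.1, Finset.mem_insert_of_mem hτ.2.1, ?_, ?_⟩
    · intro F hF
      rcases Finset.mem_insert.1 hF with rfl | hF
      · exact (hG ∅ hτ.1).2.1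
      · exact hτ.2.2.1 F hF
    · intro F hF H hH
      rcases Finset.mem_insert.1 hF with hF' | hF'
      · rcases Finset.mem_insert.1 hH with hH' | hH'
        · rw [hF', hH']; exact Or.inl subset_rfl
        · rw [hF']
          rcases (hG H hH').2.2 with h | h
          · exact Or.inr h.1
          · exact Or.inl h.1
      · rcases Finset.mem_insert.1 hH with hH' | hH'
        · rw [hH']
          rcases (hG F hF').2.2 with h | h
          · exact Or.inl h.1
          · exact Or.inr h.1
        · exact hτ.2.2.2 F hF' H hH'
  link_nonempty := by
    intro τ hτ hc
    have := card_miss hτ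
    obtain ⟨k, hk⟩ : (M.miss τ).Nonempty := by rw [← Finset.card_pos]; omega
    obtain ⟨P, hP, Q, hQ, hPQ, h1, h2, h3⟩ := exists_gap hτ hk
    obtain ⟨G, hG, _⟩ := exists_link hτ hP hQ hPQ (fun H hH => (h3 H hH).imp And.left And.left)
      (by omega)
    exact ⟨G, hG⟩
  dual := fun τ F hτ hF => exists_dual hτ hF

theorem mem_flk {τ : Finset (Finset E)} {G : Finset E} :
    G ∈ M.fcx.lk τ ↔ ∀ F ∈ τ, M.fadj F G := RW.Cx.mem_lk

theorem flk_flat {τ : Finset (Finset E)} (hτ : M.FFace τ) {G : Finset E} (hG : G ∈ M.fcx.lk τ) :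
    M.IsFlat G := (mem_flk.1 hG ∅ hτ.1).2.1

theorem fadj_rank {F G : Finset E} (h : M.fadj F G) :
    (F ⊂ G ↔ M.rank F < M.rank G) ∧ (G ⊂ F ↔ M.rank G < M.rank F) := by
  rcases h.2.2 with h' | h'
  · have := rank_lt h.1 h'
    refine ⟨by tauto, fun h2 => ?_, fun h2 => ?_⟩
    · exact absurd (h2.trans h') (ssubset_irrefl _)
    · omega
  · have := rank_lt h.2.1 h'
    refine ⟨⟨fun h2 => ?_, fun h2 => ?_⟩, by tauto⟩
    · exact absurd (h2.trans h') (ssubset_irrefl _)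
    · omega

theorem flk_miss {τ : Finset (Finset E)} {G : Finset E} (hG : G ∈ M.fcx.lk τ) :
    M.rank G ∈ M.miss τ := by
  rw [mem_miss]
  refine ⟨rank_le_rk G, fun F hF h => ?_⟩
  have h1 := mem_flk.1 hG F hF
  have := fadj_rank h1
  rcases h1.2.2 with h' | h'
  · have := this.1.1 h'; omega
  · have := this.2.1 h'; omega

/-- If the gap around `k` is of length two, its link is the set of covers. -/
theorem flk_filter {τ : Finset (Finset E)} (hτ : M.FFace τ) {P Q : Finset E} {k : ℕ}
    (hP : P ∈ τ) (hQ : Q ∈ τ) (hgap : ∀ H ∈ τ, H ⊆ P ∨ Q ⊆ H)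
    (h1 : M.rank P < k) (h2 : k < M.rank Q) (G : Finset E) :
    (G ∈ M.fcx.lk τ ∧ M.rank G = k) ↔ (M.IsFlat G ∧ P ⊆ G ∧ G ⊆ Q ∧ M.rank G = k) := by
  constructor
  · rintro ⟨hG, hk⟩
    have hp := fadj_rank (mem_flk.1 hG P hP)
    have hq := fadj_rank (mem_flk.1 hG Q hQ)
    exact ⟨flk_flat hτ hG, (hp.1.2 (by omega)).1, (hq.2.2 (by omega)).1, hk⟩
  · rintro ⟨hf, hPG, hGQ, hk⟩
    refine ⟨mem_flk.2 (link_of_gap hτ hgap hf ?_ ?_), hk⟩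
    · exact Finset.ssubset_iff_subset_ne.2 ⟨hPG, fun h => by rw [h] at h1; omega⟩
    · exact Finset.ssubset_iff_subset_ne.2 ⟨hGQ, fun h => by rw [h] at hk; omega⟩

theorem fcx_balanced : M.fcx.Balanced := by
  intro τ hτ hc l hl h0
  change M.FFace τ at hτ
  change τ.card + 1 = M.rk + 1 at hc
  have hm := card_miss hτ
  obtain ⟨k, hk⟩ := Finset.card_eq_one.1 (show (M.miss τ).card = 1 by omega)
  have hkm : k ∈ M.miss τ := by simp [hk]
  obtain ⟨P, hP, Q, hQ, hPQ, h1, h2, h3⟩ := exists_gap hτ hkm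
  have h3' : ∀ H ∈ τ, H ⊆ P ∨ Q ⊆ H := fun H hH => (h3 H hH).imp And.left And.left
  have hr : M.rank P + 1 = k := by
    by_contra hne
    have : k - 1 ∉ M.miss τ := by simp [hk]; omega
    rw [mem_miss] at this hkm
    push Not at this
    obtain ⟨H, hH, hHk⟩ := this (by omega)
    rcases h3 H hH with h | h
    · have := rank_mono (M := M) h.1; omega
    · omega
  have : M.fcx.lk τ = M.cov P Q := by
    ext G
    rw [mem_cov, hr, ← flk_filter hτ hP hQ h3' h1 h2 G]
    refine ⟨fun h => ⟨h, ?_⟩, fun h => h.1⟩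
    have := flk_miss h
    rw [hk] at this; simpa using this
  rw [this]
  have := aff_cov (M := M) hl (hτ.2.2.1 P hP) (hτ.2.2.1 Q hQ) hPQ.1
  simpa [h0 P hP, h0 Q hQ] using this

theorem fcx_conn : M.fcx.Conn := by
  intro τ hτ hc z hz G hG H hH
  change M.FFace τ at hτ
  change τ.card + 3 ≤ M.rk + 1 at hc
  have hm := card_miss hτ
  have hGm := flk_miss hG
  have hGf := flk_flat hτ hG
  have hHf := flk_flat hτ hH
  have step : ∀ A ∈ M.fcx.lk τ, ∀ B ∈ M.fcx.lk τ, A ⊆ B → z A = z B := by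
    intro A hA B hB h
    by_cases hAB : A = B
    · rw [hAB]
    · exact hz A hA B hB ⟨flk_flat hτ hA, flk_flat hτ hB,
        Or.inl (Finset.ssubset_iff_subset_ne.2 ⟨h, hAB⟩)⟩
  obtain ⟨P, hP, Q, hQ, hPQ, h1, h2, h3⟩ := exists_gap hτ hGm
  have h3' : ∀ H ∈ τ, H ⊆ P ∨ Q ⊆ H := fun H hH => (h3 H hH).imp And.left And.left
  have hPf := hτ.2.2.1 P hP
  have hQf := hτ.2.2.1 Q hQ
  have hPG : P ⊂ G := (fadj_rank (mem_flk.1 hG P hP)).1.2 h1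
  have hGQ : G ⊂ Q := (fadj_rank (mem_flk.1 hG Q hQ)).2.2 h2
  rcases (mem_flk.1 hH P hP).2.2 with hPH | hPH
  swap
  · exact (step H hH G hG (hPH.1.trans hPG.1)).symm
  rcases (mem_flk.1 hH Q hQ).2.2 with hHQ | hHQ
  · exact step G hG H hH (hGQ.1.trans hHQ.1)
  by_cases hlen : M.rank P + 3 ≤ M.rank Q
  · obtain ⟨a, haG, haP⟩ := Finset.exists_of_ssubset hPG
    obtain ⟨b, hbH, hbP⟩ := Finset.exists_of_ssubset hPH
    have mk : ∀ K, M.IsFlat K → P ⊂ K → K ⊆ Q → M.rank K < M.rank Q → K ∈ M.fcx.lk τ := by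
      intro K hK hPK hKQ hKr
      refine mem_flk.2 (link_of_gap hτ h3' hK hPK ?_)
      exact Finset.ssubset_iff_subset_ne.2 ⟨hKQ, fun h => by rw [h] at hKr; omega⟩
    have ra := rank_ad hPf haP
    have rb := rank_ad hPf hbP
    have hA := mk _ (ad_flat P a) (ssubset_ad haP) (ad_subset hQf (hGQ.1 haG) hPQ.1) (by omega)
    have hB := mk _ (ad_flat P b) (ssubset_ad hbP) (ad_subset hQf (hHQ.1 hbH) hPQ.1) (by omega)
    have hL := mk (M.ad (M.ad P a) b) (ad_flat _ b)
      ((ssubset_ad haP).trans_subset (subset_ad _ _))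
      (ad_subset hQf (hHQ.1 hbH) (ad_subset hQf (hGQ.1 haG) hPQ.1)) (by
        have : M.rank (M.ad (M.ad P a) b) ≤ M.rank (M.ad P a) + 1 := by
          unfold ad; rw [rank_closure]; exact rank_insert_le _ _
        omega)
    rw [← step _ hA G hG (ad_subset hGf haG hPG.1), ← step _ hB H hH (ad_subset hHf hbH hPH.1),
      step _ hA _ hL (subset_ad _ _)]
    exact (step _ hB _ hL (ad_subset (ad_flat _ _) (mem_ad _ _)
      ((subset_ad P a).trans (subset_ad _ b)))).symm
  · -- another gap
    obtain ⟨k, hk, hkne⟩ : ∃ k ∈ M.miss τ, k ≠ M.rank G :=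
      Finset.exists_mem_ne (by omega) _
    obtain ⟨P', hP', Q', hQ', hPQ', h1', h2', h3p⟩ := exists_gap hτ hk
    obtain ⟨K, hK, hPK, hKQ⟩ := exists_link hτ hP' hQ' hPQ'
      (fun H hH => (h3p H hH).imp And.left And.left) (by omega)
    have hK : K ∈ M.fcx.lk τ := mem_flk.2 hK
    have hkP : M.rank P ≠ k := (mem_miss.1 hk).2 P hP
    have hkQ : M.rank Q ≠ k := (mem_miss.1 hk).2 Q hQ
    rcases h3p P hP with h | h
    · rcases h3p Q hQ with h' | h'
      · have e : Q ⊆ K := h'.1.trans hPK.1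
        rw [step G hG K hK (hGQ.1.trans e), step H hH K hK (hHQ.1.trans e)]
      · omega
    · have e : K ⊆ P := hKQ.1.trans h.1
      rw [← step K hK G hG (e.trans hPG.1), ← step K hK H hH (e.trans hPH.1)]

end FinMatroid


namespace FinMatroid

open RW.Cx

variable {E : Type*} [Fintype E] [DecidableEq E] {M : FinMatroid E}

theorem HR_base_of {τ : Finset (Finset E)} (hτ : M.FFace τ) (hc : τ.card + 2 = M.rk + 1)
    (L : Finset (Finset E))
    (h : ∀ z, ∑ G ∈ L, (z - M.fcx.ip τ z) G = 0 → M.fcx.Phi [z, z] τ ≤ 0) :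
    M.fcx.HR [] τ := by
  intro x v hv
  set s : (Finset E → ℝ) → ℝ := fun z => ∑ G ∈ L, (z - M.fcx.ip τ z) G with hs
  have hlin : ∀ t : ℝ, s (x - t • v) = s x - t * s v := by
    intro t
    have : x - t • v = x + (-t) • v := by rw [neg_smul, sub_eq_add_neg]
    simp only [hs]
    rw [this, ip_add, ip_smul, Finset.mul_sum, ← Finset.sum_sub_distrib]
    refine Finset.sum_congr rfl fun G _ => ?_
    simp only [Pi.sub_apply, Pi.add_apply, Pi.smul_apply, smul_eq_mul]; ring
  have hsv : s v ≠ 0 := by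
    intro h0
    have h1 := h v h0
    have h2 : 0 < M.fcx.Phi [v, v] τ :=
      Phi_pos fcx_balanced [v, v] (by simpa using hv) hτ hc
    linarith
  refine HR_of (vs := []) fcx_balanced hτ hc (by simp) x v hv (s x / s v) ?_
  apply h
  have := hlin (s x / s v)
  rw [div_mul_cancel₀ _ hsv, sub_self] at this
  exact this

theorem gap_two {τ : Finset (Finset E)} (hτ : M.FFace τ) {k : ℕ} (hk : k ∈ M.miss τ) :
    ∃ P ∈ τ, ∃ Q ∈ τ, P ⊂ Q ∧ M.rank P < k ∧ k < M.rank Q ∧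
      (∀ H ∈ τ, H ⊆ P ∨ Q ⊆ H) ∧ (k - 1 ∉ M.miss τ → M.rank P + 1 = k) ∧
      (∀ j, k < j → j ≤ M.rk → j ∉ M.miss τ → M.rank Q ≤ j) := by
  obtain ⟨P, hP, Q, hQ, hPQ, h1, h2, h3⟩ := exists_gap hτ hk
  have hkm := mem_miss.1 hk
  refine ⟨P, hP, Q, hQ, hPQ, h1, h2, fun H hH => (h3 H hH).imp And.left And.left, ?_, ?_⟩
  · intro h
    rw [mem_miss] at h
    push Not at h
    obtain ⟨H, hH, hHk⟩ := h (by omega)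
    rcases h3 H hH with h | h
    · have := rank_mono (M := M) h.1; omega
    · omega
  · intro j hj hjr h
    rw [mem_miss] at h
    push Not at h
    obtain ⟨H, hH, hHk⟩ := h hjr
    rcases h3 H hH with h | h
    · omega
    · have := rank_mono (M := M) h.1; omega

theorem Phi_one {τ : Finset (Finset E)} (hτ : M.FFace τ) (hc : τ.card + 2 = M.rk + 1)
    (z : Finset E → ℝ) {G : Finset E} (hG : G ∈ M.fcx.lk τ) :
    ∃ m ∈ affW E, (∀ F ∈ τ, m F = 0) ∧ m G = 1 ∧
    M.fcx.Phi [z] (insert G τ) = ∑ H ∈ M.fcx.lk (insert G τ), (z - M.fcx.ip τ z) H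
      - (z - M.fcx.ip τ z) G * ∑ H ∈ M.fcx.lk (insert G τ), m H := by
  obtain ⟨m, hm, hm1, hm0⟩ := exists_dual (face_ins (C := M.fcx) hτ hG) (Finset.mem_insert_self G τ)
  have hm0' : ∀ F ∈ τ, m F = 0 := fun F hF => hm0 F (Finset.mem_insert_of_mem hF)
    (fun h => not_mem_of_mem_lk hG (h ▸ hF))
  refine ⟨m, hm, hm0', hm1, ?_⟩
  rw [Phi_ins (ys := []) fcx_balanced hτ hc z hG m hm hm0' hm1]
  simp only [Phi_nil, mul_one]
  rw [Finset.sum_sub_distrib, Finset.mul_sum]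

theorem base_apart {τ : Finset (Finset E)} (hτ : M.FFace τ) (hc : τ.card + 2 = M.rk + 1)
    {k₁ k₂ : ℕ} (hk : M.miss τ = {k₁, k₂}) (hlt : k₁ + 1 < k₂) : M.fcx.HR [] τ := by
  classical
  have hk1 : k₁ ∈ M.miss τ := by simp [hk]
  have hk2 : k₂ ∈ M.miss τ := by simp [hk]
  obtain ⟨P, hP, Q, hQ, hPQ, h1, h2, hg, h3, h4⟩ := gap_two hτ hk1
  obtain ⟨P', hP', Q', hQ', hPQ', h1', h2', hg', h3', h4'⟩ := gap_two hτ hk2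
  have r1 := h3 (by simp [hk]; omega)
  have b2 := (mem_miss.1 hk2).1
  have r2 := h4 (k₁ + 1) (by omega) (by omega) (by simp [hk]; omega)
  have r1' := h3' (by simp [hk]; omega)
  have hQ'le := rank_le_rk (M := M) Q'
  have r2' := h4' (k₂ + 1) (by omega) (by omega) (by simp [hk]; omega)
  have L1 : ∀ G, (G ∈ M.fcx.lk τ ∧ M.rank G = k₁) ↔ G ∈ M.cov P Q := fun G => by
    rw [mem_cov, flk_filter hτ hP hQ hg h1 h2, r1]
  have L2 : ∀ G, (G ∈ M.fcx.lk τ ∧ M.rank G = k₂) ↔ G ∈ M.cov P' Q' := fun G => by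
    rw [mem_cov, flk_filter hτ hP' hQ' hg' h1' h2', r1']
  have hLL : M.fcx.lk τ = M.cov P Q ∪ M.cov P' Q' := by
    ext G
    rw [Finset.mem_union, ← L1, ← L2]
    refine ⟨fun h => ?_, fun h => h.elim And.left And.left⟩
    have := flk_miss h
    simp only [hk, Finset.mem_insert, Finset.mem_singleton] at this
    tauto
  have hdis : Disjoint (M.cov P Q) (M.cov P' Q') := by
    rw [Finset.disjoint_left]
    intro G h h'
    rw [← L1] at h
    rw [← L2] at h'
    omega
  have hadj : ∀ G ∈ M.cov P Q, ∀ H ∈ M.cov P' Q', M.fadj G H := by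
    intro G hG H hH
    have hGf := (mem_cov.1 hG).1
    have hHf := (mem_cov.1 hH).1
    have hH' := (L2 H).2 hH
    have : Q ⊂ H := (fadj_rank (mem_flk.1 hH'.1 Q hQ)).1.2 (by omega)
    exact ⟨hGf, hHf, Or.inl (lt_of_le_of_lt (mem_cov.1 hG).2.2.1 this)⟩
  have hl1 : ∀ G ∈ M.cov P Q, M.fcx.lk (insert G τ) = M.cov P' Q' := by
    intro G hG
    ext H
    rw [mem_lk_insert]
    constructor
    · rintro ⟨ha, hH⟩
      rw [hLL, Finset.mem_union] at hH
      refine hH.resolve_left fun hH => ?_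
      have e1 := ((L1 G).2 hG).2
      have e2 := ((L1 H).2 hH).2
      have := fadj_rank ha
      rcases ha.2.2 with h | h
      · have := this.1.1 h; omega
      · have := this.2.1 h; omega
    · exact fun hH => ⟨hadj G hG H hH, ((L2 H).2 hH).1⟩
  have hl2 : ∀ G ∈ M.cov P' Q', M.fcx.lk (insert G τ) = M.cov P Q := by
    intro G hG
    ext H
    rw [mem_lk_insert]
    constructor
    · rintro ⟨ha, hH⟩
      rw [hLL, Finset.mem_union] at hH
      refine hH.resolve_right fun hH => ?_
      have e1 := ((L2 G).2 hG).2
      have e2 := ((L2 H).2 hH).2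
      have := fadj_rank ha
      rcases ha.2.2 with h | h
      · have := this.1.1 h; omega
      · have := this.2.1 h; omega
    · exact fun hH => ⟨M.fcx.adj_symm (hadj H hH G hG), ((L1 H).2 hH).1⟩
  refine HR_base_of hτ hc (M.cov P Q) fun z hz => ?_
  set Z := z - M.fcx.ip τ z with hZ
  have p1 : ∀ G ∈ M.cov P Q, M.fcx.Phi [z] (insert G τ) = ∑ H ∈ M.cov P' Q', Z H := by
    intro G hG
    obtain ⟨m, hm, hm0, hm1, e⟩ := Phi_one hτ hc z ((L1 G).2 hG).1
    have := aff_cov (M := M) hm (hτ.2.2.1 P' hP') (hτ.2.2.1 Q' hQ') hPQ'.1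
    simp only [hm0 P' hP', hm0 Q' hQ', sub_zero] at this
    rw [e, hl1 G hG, this]; simp [hZ]
  have p2 : ∀ G ∈ M.cov P' Q', M.fcx.Phi [z] (insert G τ) = ∑ H ∈ M.cov P Q, Z H := by
    intro G hG
    obtain ⟨m, hm, hm0, hm1, e⟩ := Phi_one hτ hc z ((L2 G).2 hG).1
    have := aff_cov (M := M) hm (hτ.2.2.1 P hP) (hτ.2.2.1 Q hQ) hPQ.1
    simp only [hm0 P hP, hm0 Q hQ, sub_zero] at this
    rw [e, hl2 G hG, this]; simp [hZ]
  have : M.fcx.Phi [z, z] τ = 0 := by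
    rw [Phi_cons, hLL, Finset.sum_union hdis]
    have q1 : ∑ G ∈ M.cov P Q, (z G - M.fcx.ip τ z G) * M.fcx.Phi [z] (insert G τ) =
        (∑ G ∈ M.cov P Q, Z G) * ∑ H ∈ M.cov P' Q', Z H := by
      rw [Finset.sum_mul]
      exact Finset.sum_congr rfl fun G hG => by rw [p1 G hG]; rfl
    have q2 : ∑ G ∈ M.cov P' Q', (z G - M.fcx.ip τ z G) * M.fcx.Phi [z] (insert G τ) =
        (∑ G ∈ M.cov P' Q', Z G) * ∑ H ∈ M.cov P Q, Z H := by
      rw [Finset.sum_mul]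
      exact Finset.sum_congr rfl fun G hG => by rw [p2 G hG]; rfl
    rw [q1, q2, hz]; ring
  exact this.le

theorem cov_join (Z : Finset E → ℝ) {P Q p : Finset E} (hP : M.IsFlat P) (hQ : M.IsFlat Q)
    (hp : p ∈ M.cov P Q) :
    ∑ l ∈ M.cov p Q, ∑ q ∈ (M.cov P l).erase p, Z q = ∑ q ∈ (M.cov P Q).erase p, Z q := by
  classical
  have hp' := mem_cov.1 hp
  have key : ∀ q ∈ (M.cov P Q).erase p, M.closure (q ∪ p) ∈ M.cov p Q ∧ ∀ l ∈ M.cov p Q, q ⊆ l →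
      M.closure (q ∪ p) = l := by
    intro q hq
    rw [Finset.mem_erase, mem_cov] at hq
    obtain ⟨hqp, hqf, hPq, hqQ, hqr⟩ := hq
    have : ¬ q ⊆ p := fun h => hqp (flat_eq_of_subset hqf h (by omega))
    obtain ⟨x, hxq, hxp⟩ := Finset.not_subset.1 this
    have hxP : x ∉ P := fun h => hxp (hp'.2.1 h)
    have e1 := eq_ad hP hqf hPq hqr hxq hxP
    have e2 : M.closure (q ∪ p) = M.ad p x := by
      apply le_antisymm
      · refine closure_subset_of_flat (ad_flat p x) (Finset.union_subset ?_ (subset_ad p x))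
        rw [← e1]
        exact ad_subset (ad_flat p x) (mem_ad p x) (hp'.2.1.trans (subset_ad p x))
      · exact closure_mono (Finset.insert_subset (Finset.mem_union_left _ hxq)
          Finset.subset_union_right)
    rw [e2]
    refine ⟨mem_cov.2 ⟨ad_flat p x, subset_ad p x, ad_subset hQ (hqQ hxq) hp'.2.2.1,
      rank_ad hp'.1 hxp⟩, fun l hl hql => ?_⟩
    have hl := mem_cov.1 hl
    exact eq_ad hp'.1 hl.1 hl.2.1 hl.2.2.2 (hql hxq) hxp
  rw [← Finset.sum_fiberwise_of_maps_to (fun q hq => (key q hq).1)]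
  refine Finset.sum_congr rfl fun l hl => Finset.sum_congr ?_ fun _ _ => rfl
  ext q
  rw [Finset.mem_filter]
  constructor
  · intro hq
    have hq' : q ∈ (M.cov P Q).erase p := by
      rw [Finset.mem_erase, mem_cov] at hq ⊢
      exact ⟨hq.1, hq.2.1, hq.2.2.1, hq.2.2.2.1.trans (mem_cov.1 hl).2.2.1, hq.2.2.2.2⟩
    refine ⟨hq', (key q hq').2 l hl ?_⟩
    exact (mem_cov.1 (Finset.mem_erase.1 hq).2).2.2.1
  · rintro ⟨hq, rfl⟩
    rw [Finset.mem_erase, mem_cov] at hq ⊢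
    exact ⟨hq.1, hq.2.1, hq.2.2.1, Finset.subset_union_left.trans (subset_closure _), hq.2.2.2.2⟩

theorem base_adj {τ : Finset (Finset E)} (hτ : M.FFace τ) (hc : τ.card + 2 = M.rk + 1)
    {k : ℕ} (hk : M.miss τ = {k, k + 1}) : M.fcx.HR [] τ := by
  classical
  have hk1 : k ∈ M.miss τ := by simp [hk]
  have hk2 : k + 1 ∈ M.miss τ := by simp [hk]
  obtain ⟨P, hP, Q, hQ, hPQ, h1, h2, hg, h3, h4⟩ := gap_two hτ hk1
  have r1 := h3 (by simp [hk]; omega)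
  have hQle := rank_le_rk (M := M) Q
  have hQne := (mem_miss.1 hk2).2 Q hQ
  have r2 := h4 (k + 2) (by omega) (by omega) (by simp [hk])
  have hPf := hτ.2.2.1 P hP
  have hQf := hτ.2.2.1 Q hQ
  set L : Finset (Finset E) := (M.fcx.lk τ).filter fun G => M.rank G = k + 1 with hL
  have L1 : ∀ G, (G ∈ M.fcx.lk τ ∧ M.rank G = k) ↔ G ∈ M.cov P Q := fun G => by
    rw [mem_cov, flk_filter hτ hP hQ hg h1 h2, r1]
  have L2 : ∀ G, G ∈ L ↔ M.IsFlat G ∧ P ⊆ G ∧ G ⊆ Q ∧ M.rank G = k + 1 := fun G => by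
    rw [← flk_filter hτ hP hQ hg (by omega) (by omega), hL, Finset.mem_filter]
  have hLL : M.fcx.lk τ = M.cov P Q ∪ L := by
    ext G
    rw [Finset.mem_union, ← L1, hL, Finset.mem_filter]
    refine ⟨fun h => ?_, fun h => h.elim And.left And.left⟩
    have := flk_miss h
    simp only [hk, Finset.mem_insert, Finset.mem_singleton] at this
    tauto
  have hdis : Disjoint (M.cov P Q) L := by
    rw [Finset.disjoint_left]
    intro G h h'
    rw [← L1] at h
    rw [L2] at h'
    omega
  have memL : ∀ p l, (p ∈ M.cov P Q ∧ l ∈ M.cov p Q) ↔ (p ∈ M.cov P l ∧ l ∈ L) := by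
    intro p l
    rw [mem_cov, mem_cov, mem_cov, L2]
    constructor
    · rintro ⟨⟨a1, a2, a3, a4⟩, b1, b2, b3, b4⟩
      exact ⟨⟨a1, a2, b2, a4⟩, b1, a2.trans b2, b3, by omega⟩
    · rintro ⟨⟨a1, a2, a3, a4⟩, b1, b2, b3, b4⟩
      exact ⟨⟨a1, a2, a3.trans b3, a4⟩, b1, a3, b3, by omega⟩
  have hl1 : ∀ G ∈ M.cov P Q, M.fcx.lk (insert G τ) = M.cov G Q := by
    intro G hG
    ext H
    rw [mem_lk_insert]
    have e1 := ((L1 G).2 hG).2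
    constructor
    · rintro ⟨ha, hH⟩
      have hr := flk_miss hH
      simp only [hk, Finset.mem_insert, Finset.mem_singleton] at hr
      rcases ha.2.2 with h | h
      · have := (fadj_rank ha).1.1 h
        have hHL : H ∈ L := by rw [hL, Finset.mem_filter]; exact ⟨hH, by omega⟩
        have := (L2 H).1 hHL
        exact mem_cov.2 ⟨this.1, h.1, this.2.2.1, by omega⟩
      · have := (fadj_rank ha).2.1 h; omega
    · intro hH
      have := (memL G H).1 ⟨hG, hH⟩
      refine ⟨⟨(mem_cov.1 hG).1, (mem_cov.1 hH).1, Or.inl ?_⟩, by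
        rw [hLL]; exact Finset.mem_union_right _ this.2⟩
      refine Finset.ssubset_iff_subset_ne.2 ⟨(mem_cov.1 hH).2.1, fun h => ?_⟩
      have := (mem_cov.1 hH).2.2.2
      rw [h] at this; omega
  have hl2 : ∀ G ∈ L, M.fcx.lk (insert G τ) = M.cov P G := by
    intro G hG
    ext H
    rw [mem_lk_insert]
    have e1 := ((L2 G).1 hG).2.2.2
    constructor
    · rintro ⟨ha, hH⟩
      have hr := flk_miss hH
      simp only [hk, Finset.mem_insert, Finset.mem_singleton] at hr
      rcases ha.2.2 with h | h
      · have := (fadj_rank ha).1.1 h; omega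
      · have := (fadj_rank ha).2.1 h
        have := (L1 H).1 ⟨hH, by omega⟩
        rw [mem_cov] at this ⊢
        exact ⟨this.1, this.2.1, h.1, this.2.2.2⟩
    · intro hH
      have := (memL H G).2 ⟨hH, hG⟩
      refine ⟨⟨((L2 G).1 hG).1, (mem_cov.1 hH).1, Or.inr ?_⟩, by
        rw [hLL]; exact Finset.mem_union_left _ this.1⟩
      refine Finset.ssubset_iff_subset_ne.2 ⟨(mem_cov.1 hH).2.2.1, fun h => ?_⟩
      have := (mem_cov.1 hH).2.2.2
      rw [h] at this; omega
  refine HR_base_of hτ hc (M.cov P Q) fun z hz => ?_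
  set Z := z - M.fcx.ip τ z with hZ
  have p1 : ∀ G ∈ M.cov P Q, M.fcx.Phi [z] (insert G τ) =
      ∑ H ∈ M.cov G Q, Z H - Z G * ((M.cov G Q).card - 1) := by
    intro G hG
    obtain ⟨m, hm, hm0, hm1, e⟩ := Phi_one hτ hc z ((L1 G).2 hG).1
    have := aff_cov (M := M) hm (mem_cov.1 hG).1 hQf (mem_cov.1 hG).2.2.1
    simp only [hm1, hm0 Q hQ, Finset.sum_sub_distrib, Finset.sum_const, nsmul_eq_mul, mul_one]
      at this
    rw [e, hl1 G hG, show ∑ H ∈ M.cov G Q, m H = (M.cov G Q).card - 1 by linarith]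
  have p2 : ∀ G ∈ L, M.fcx.Phi [z] (insert G τ) = ∑ H ∈ M.cov P G, Z H - Z G := by
    intro G hG
    have hG' := (L2 G).1 hG
    obtain ⟨m, hm, hm0, hm1, e⟩ := Phi_one hτ hc z
      (show G ∈ M.fcx.lk τ by rw [hLL]; exact Finset.mem_union_right _ hG)
    have := aff_cov (M := M) hm hPf hG'.1 hG'.2.1
    simp only [hm1, hm0 P hP, sub_zero] at this
    rw [e, hl2 G hG, this, mul_one]
  -- line sums
  set a : Finset E → ℝ := fun l => ∑ p ∈ M.cov P l, Z p with ha
  have swap : ∀ f : Finset E → ℝ, ∑ p ∈ M.cov P Q, Z p * ∑ l ∈ M.cov p Q, f l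
      = ∑ l ∈ L, a l * f l := by
    intro f
    simp only [Finset.mul_sum, ha, Finset.sum_mul]
    exact Finset.sum_comm' memL
  have join : ∀ p ∈ M.cov P Q, ∑ l ∈ M.cov p Q, a l = ((M.cov p Q).card - 1) * Z p := by
    intro p hp
    have h := cov_join Z hPf hQf hp
    have e1 : ∑ q ∈ (M.cov P Q).erase p, Z q = - Z p := by
      have := Finset.add_sum_erase _ Z hp
      linarith
    have e2 : ∀ l ∈ M.cov p Q, a l = Z p + ∑ q ∈ (M.cov P l).erase p, Z q := fun l hl =>
      (Finset.add_sum_erase _ Z ((memL p l).1 ⟨hp, hl⟩).1).symm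
    rw [Finset.sum_congr rfl e2, Finset.sum_add_distrib, h, e1, Finset.sum_const, nsmul_eq_mul]
    ring
  have sq : ∑ l ∈ L, a l * a l = ∑ p ∈ M.cov P Q, Z p * (((M.cov p Q).card - 1) * Z p) := by
    rw [← swap]
    exact Finset.sum_congr rfl fun p hp => by rw [join p hp]
  have tot : M.fcx.Phi [z, z] τ = - ∑ l ∈ L, (Z l - a l) ^ 2 := by
    rw [Phi_cons, hLL, Finset.sum_union hdis]
    have t1 : ∑ G ∈ M.cov P Q, (z G - M.fcx.ip τ z G) * M.fcx.Phi [z] (insert G τ) =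
        ∑ l ∈ L, a l * Z l - ∑ l ∈ L, a l * a l := by
      rw [sq, ← swap, ← Finset.sum_sub_distrib]
      refine Finset.sum_congr rfl fun G hG => ?_
      rw [p1 G hG]
      change Z G * _ = _
      ring
    have t2 : ∑ G ∈ L, (z G - M.fcx.ip τ z G) * M.fcx.Phi [z] (insert G τ) =
        ∑ l ∈ L, Z l * (a l - Z l) :=
      Finset.sum_congr rfl fun G hG => by rw [p2 G hG]; rfl
    rw [t1, t2, ← Finset.sum_sub_distrib, ← Finset.sum_add_distrib, ← Finset.sum_neg_distrib]
    exact Finset.sum_congr rfl fun G _ => by ring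
  rw [tot, neg_nonpos]
  exact Finset.sum_nonneg fun l _ => sq_nonneg _

theorem fcx_base : ∀ τ, M.fcx.Face τ → τ.card + 2 = M.fcx.N → M.fcx.HR [] τ := by
  intro τ hτ hc
  change M.FFace τ at hτ
  change τ.card + 2 = M.rk + 1 at hc
  have hm := card_miss hτ
  obtain ⟨a, b, hab, hk⟩ := Finset.card_eq_two.1 (show (M.miss τ).card = 2 by omega)
  wlog h : a < b generalizing a b
  · exact this b a hab.symm (by rw [hk, Finset.pair_comm]) (by omega)
  by_cases h1 : b = a + 1
  · subst h1; exact base_adj hτ hc hk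
  · exact base_apart hτ hc hk (by omega)

end FinMatroid


namespace FinMatroid

open RW.Cx

variable {E : Type*} [Fintype E] [DecidableEq E] {M : FinMatroid E}

/-- The class `α`. -/
noncomputable def al (E : Type*) [Fintype E] [DecidableEq E] : Finset E → ℝ :=
  fun S => if S = Finset.univ then -1 else 0

/-- The class `β`. -/
noncomputable def be (E : Type*) [Fintype E] [DecidableEq E] : Finset E → ℝ :=
  fun S => if S = ∅ then -1 else 0

theorem lk_ne_univ {τ : Finset (Finset E)} (hτ : M.FFace τ) {G : Finset E}
    (hG : G ∈ M.fcx.lk τ) : G ≠ Finset.univ :=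
  fun h => not_mem_of_mem_lk hG (h ▸ hτ.2.1)

theorem lk_ne_empty {τ : Finset (Finset E)} (hτ : M.FFace τ) {G : Finset E}
    (hG : G ∈ M.fcx.lk τ) : G ≠ ∅ :=
  fun h => not_mem_of_mem_lk hG (h ▸ hτ.1)

theorem al_lin {τ : Finset (Finset E)} (hτ : M.FFace τ) {i : E}
    (hi : ∀ F ∈ τ, F ≠ Finset.univ → i ∉ F) :
    ∃ l ∈ affW E, (∀ F ∈ τ, l F = al E F) ∧
      ∀ G ∈ M.fcx.lk τ, al E G - l G = if i ∈ G then 1 else 0 := by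
  refine ⟨_, Submodule.neg_mem _ (ind_mem i), fun F hF => ?_, fun G hG => ?_⟩
  · by_cases h : F = Finset.univ
    · simp [al, h]
    · simp [al, h, hi F hF h]
  · simp [al, lk_ne_univ hτ hG]

theorem be_lin {τ : Finset (Finset E)} (hτ : M.FFace τ) {i : E}
    (hi : ∀ F ∈ τ, F ≠ ∅ → i ∈ F) :
    ∃ l ∈ affW E, (∀ F ∈ τ, l F = be E F) ∧
      ∀ G ∈ M.fcx.lk τ, be E G - l G = if i ∈ G then 0 else 1 := by
  refine ⟨_, Submodule.add_mem _ (const_mem (-1)) (ind_mem i), fun F hF => ?_, fun G hG => ?_⟩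
  · by_cases h : F = ∅
    · simp [be, h]
    · simp [be, h, hi F hF h]
  · by_cases h : i ∈ G <;> simp [be, lk_ne_empty hτ hG, h]

theorem al_exists [Nonempty E] {τ : Finset (Finset E)} (hτ : M.FFace τ) :
    ∃ i, ∀ F ∈ τ, F ≠ Finset.univ → i ∉ F := by
  obtain ⟨P, hP, hPu, hmax⟩ := exists_pred hτ (Finset.univ_nonempty (α := E))
  obtain ⟨i, _, hi⟩ := Finset.exists_of_ssubset hPu
  exact ⟨i, fun F hF hne h => hi (hmax F hF (Finset.ssubset_univ_iff.2 hne) h)⟩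

theorem be_exists [Nonempty E] {τ : Finset (Finset E)} (hτ : M.FFace τ) :
    ∃ i, ∀ F ∈ τ, F ≠ ∅ → i ∈ F := by
  obtain ⟨P, hP, hPu, hmin⟩ := exists_succ hτ (Finset.univ_nonempty (α := E)).ne_empty.symm
  obtain ⟨i, hi, _⟩ := Finset.exists_of_ssubset hPu
  exact ⟨i, fun F hF hne => hmin F hF (Finset.empty_ssubset.2
    (Finset.nonempty_iff_ne_empty.2 hne)) hi⟩

theorem al_nef [Nonempty E] : M.fcx.Nef (al E) := by
  intro τ hτ
  obtain ⟨i, hi⟩ := al_exists (M := M) hτ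
  obtain ⟨l, hl, h1, h2⟩ := al_lin (M := M) hτ hi
  refine ⟨l, hl, h1, fun G hG => ?_⟩
  rw [h2 G hG]; split_ifs <;> norm_num

theorem be_nef [Nonempty E] : M.fcx.Nef (be E) := by
  intro τ hτ
  obtain ⟨i, hi⟩ := be_exists (M := M) hτ
  obtain ⟨l, hl, h1, h2⟩ := be_lin (M := M) hτ hi
  refine ⟨l, hl, h1, fun G hG => ?_⟩
  rw [h2 G hG]; split_ifs <;> norm_num

/-- Pair indicator. -/
noncomputable def pr (i j : E) : Finset E → ℝ := fun S => if i ∈ S ∧ j ∈ S then -1 else 0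

theorem pr_lin {τ : Finset (Finset E)} (hτ : M.FFace τ) (i j : E) :
    ∃ l ∈ affW E, (∀ F ∈ τ, l F = pr i j F) ∧ (∀ G, 0 ≤ pr i j G - l G) ∧
      ((∀ F ∈ τ, i ∈ F ↔ j ∈ F) → ∀ G, i ∈ G → j ∉ G → 0 < pr i j G - l G) := by
  by_cases hA : ∀ F ∈ τ, i ∈ F ↔ j ∈ F
  · refine ⟨_, Submodule.add_mem _ (Submodule.smul_mem _ (-(1/2)) (ind_mem i))
      (Submodule.smul_mem _ (-(1/2)) (ind_mem j)), fun F hF => ?_, fun G => ?_,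
      fun _ G hi hj => ?_⟩
    · have := hA F hF
      by_cases hi : i ∈ F
      · have hj := this.1 hi
        simp [pr, hi, hj]; norm_num
      · have hj : j ∉ F := fun h => hi (this.2 h)
        simp [pr, hi, hj]
    · by_cases hi : i ∈ G <;> by_cases hj : j ∈ G <;> simp [pr, hi, hj] <;> norm_num
    · simp [pr, hi, hj]
  · have main : ∀ a b : E, (∃ F ∈ τ, a ∈ F ∧ b ∉ F) → ∃ l ∈ affW E,
        (∀ F ∈ τ, l F = pr a b F) ∧ (∀ G, 0 ≤ pr a b G - l G) := by
      rintro a b ⟨F, hF, ha, hb⟩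
      refine ⟨_, Submodule.neg_mem _ (ind_mem b), fun H hH => ?_, fun G => ?_⟩
      · rcases hτ.2.2.2 F hF H hH with h | h
        · simp [pr, h ha]
          split_ifs <;> simp
        · have : b ∉ H := fun h' => hb (h h')
          simp [pr, this]
      · by_cases hi : a ∈ G <;> by_cases hj : b ∈ G <;> simp [pr, hi, hj]
    have comm : pr j i = pr i j := by ext S; simp [pr, and_comm]
    push Not at hA
    obtain ⟨F, hF, h⟩ := hA
    rcases h with ⟨h1, h2⟩ | ⟨h1, h2⟩
    · obtain ⟨l, hl, e1, e2⟩ := main i j ⟨F, hF, h1, h2⟩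
      exact ⟨l, hl, e1, e2, fun h => absurd ((h F hF).1 h1) h2⟩
    · obtain ⟨l, hl, e1, e2⟩ := main j i ⟨F, hF, h2, h1⟩
      rw [comm] at e1 e2
      exact ⟨l, hl, e1, e2, fun h => absurd ((h F hF).2 h2) h1⟩

theorem exists_ample : ∃ s, M.fcx.Ample s := by
  refine ⟨∑ p : E × E, pr p.1 p.2, fun τ hτ => ?_⟩
  choose l hl h1 h2 h3 using fun p : E × E => pr_lin (M := M) hτ p.1 p.2
  refine ⟨∑ p : E × E, l p, Submodule.sum_mem _ fun p _ => hl p, fun F hF => ?_, fun G hG => ?_⟩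
  · simp only [Finset.sum_apply]
    exact Finset.sum_congr rfl fun p _ => h1 p F hF
  · simp only [Finset.sum_apply]
    rw [← Finset.sum_sub_distrib]
    obtain ⟨P, hP, Q, hQ, hPQ, r1, r2, hg⟩ := exists_gap hτ (flk_miss hG)
    have hPG := (fadj_rank (mem_flk.1 hG P hP)).1.2 r1
    have hGQ := (fadj_rank (mem_flk.1 hG Q hQ)).2.2 r2
    obtain ⟨i, hi, hiP⟩ := Finset.exists_of_ssubset hPG
    obtain ⟨j, hj, hjG⟩ := Finset.exists_of_ssubset hGQ
    refine Finset.sum_pos' (fun p _ => h2 p G) ⟨(i, j), Finset.mem_univ _, h3 (i, j) ?_ G hi hjG⟩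
    intro F hF
    rcases hg F hF with h | h
    · exact ⟨fun h' => absurd (h.1 h') hiP, fun h' => absurd (hPG.1 (h.1 h')) hjG⟩
    · exact ⟨fun _ => h.1 hj, fun _ => h.1 (hGQ.1 hi)⟩

theorem ite_ite_sum {α : Type*} [DecidableEq α] (s : Finset α) (p : α → Prop) [DecidablePred p]
    (f : α → ℝ) : ∑ G ∈ s, (if p G then (1:ℝ) else 0) * f G = ∑ G ∈ s.filter p, f G := by
  rw [Finset.sum_filter]
  exact Finset.sum_congr rfl fun G _ => by split_ifs <;> simp

theorem Phi_al {τ : Finset (Finset E)} {ys : List (Finset E → ℝ)} (hτ : M.FFace τ)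
    (hc : τ.card + ys.length = M.rk) {i : E} (hi : ∀ F ∈ τ, F ≠ Finset.univ → i ∉ F) :
    M.fcx.Phi (al E :: ys) τ =
      ∑ G ∈ (M.fcx.lk τ).filter (fun G => i ∈ G), M.fcx.Phi ys (insert G τ) := by
  obtain ⟨l, hl, h1, h2⟩ := al_lin (M := M) hτ hi
  rw [Phi_eq fcx_balanced hτ (congrArg (· + 1) hc) _ l hl h1, ← ite_ite_sum]
  exact Finset.sum_congr rfl fun G hG => by rw [h2 G hG]

theorem Phi_be {τ : Finset (Finset E)} {ys : List (Finset E → ℝ)} (hτ : M.FFace τ)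
    (hc : τ.card + ys.length = M.rk) {i : E} (hi : ∀ F ∈ τ, F ≠ ∅ → i ∈ F) :
    M.fcx.Phi (be E :: ys) τ =
      ∑ G ∈ (M.fcx.lk τ).filter (fun G => i ∉ G), M.fcx.Phi ys (insert G τ) := by
  obtain ⟨l, hl, h1, h2⟩ := be_lin (M := M) hτ hi
  rw [Phi_eq fcx_balanced hτ (congrArg (· + 1) hc) _ l hl h1, ← ite_ite_sum]
  exact Finset.sum_congr rfl fun G hG => by rw [h2 G hG]; split_ifs <;> simp_all

end FinMatroid


namespace FinMatroid

open RW.Cx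

variable {E : Type*} [Fintype E] [DecidableEq E] {M : FinMatroid E}

/-- `T` is the largest proper member of the chain. -/
def IsTop (τ : Finset (Finset E)) (T : Finset E) : Prop :=
  T ∈ τ ∧ T ≠ Finset.univ ∧ ∀ F ∈ τ, F ≠ Finset.univ → F ⊆ T

/-- `K` is the smallest nonempty member of the chain. -/
def IsBot (τ : Finset (Finset E)) (K : Finset E) : Prop :=
  K ∈ τ ∧ K ≠ ∅ ∧ ∀ F ∈ τ, F ≠ ∅ → K ⊆ F

theorem rank_lt_rk {T : Finset E} (hT : M.IsFlat T) (h : T ≠ Finset.univ) : M.rank T < M.rk :=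
  rank_lt hT (Finset.ssubset_univ_iff.2 h)

theorem miss_top {τ : Finset (Finset E)} {T : Finset E} (hT : IsTop τ T) :
    Finset.Ioo (M.rank T) M.rk ⊆ M.miss τ := by
  intro k hk
  rw [Finset.mem_Ioo] at hk
  rw [mem_miss]
  refine ⟨hk.2.le, fun F hF h => ?_⟩
  by_cases hu : F = Finset.univ
  · rw [hu] at h
    have : M.rk = k := h
    omega
  · have := rank_mono (M := M) (hT.2.2 F hF hu)
    omega

theorem miss_bot {τ : Finset (Finset E)} {K : Finset E} (hK : IsBot τ K) :
    Finset.Ioo 0 (M.rank K) ⊆ M.miss τ := by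
  intro k hk
  rw [Finset.mem_Ioo] at hk
  rw [mem_miss]
  have := rank_le_rk (M := M) K
  refine ⟨by omega, fun F hF h => ?_⟩
  by_cases hu : F = ∅
  · rw [hu, rank_empty] at h
    omega
  · have := rank_mono (M := M) (hK.2.2 F hF hu)
    omega

theorem bound_top {τ : Finset (Finset E)} (hτ : M.FFace τ) {T : Finset E} (hT : IsTop τ T) {a : ℕ}
    (hc : τ.card + a = M.rk + 1) : M.rk ≤ M.rank T + a + 1 := by
  have h1 := card_miss hτ
  have h2 := Finset.card_le_card (miss_top (M := M) hT)
  rw [Nat.card_Ioo] at h2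
  omega

theorem bound_bot {τ : Finset (Finset E)} (hτ : M.FFace τ) {T K : Finset E} (hT : IsTop τ T)
    (hK : IsBot τ K) (hKT : K ⊆ T) {a : ℕ}
    (hc : τ.card + a = M.rk + 1) : (M.rank K - 1) + (M.rk - M.rank T - 1) ≤ a := by
  have h1 := card_miss hτ
  have h2 := Finset.card_le_card (Finset.union_subset (miss_bot (M := M) hK) (miss_top (M := M) hT))
  rw [Finset.card_union_of_disjoint, Nat.card_Ioo, Nat.card_Ioo] at h2
  · omega
  · rw [Finset.disjoint_left]
    intro k hk hk'
    rw [Finset.mem_Ioo] at hk hk'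
    have := rank_mono (M := M) hKT
    omega

theorem claim_one (a : ℕ) : ∀ {τ : Finset (Finset E)} (_ : M.FFace τ) {T : Finset E}
    (_ : IsTop τ T) (_ : τ.card + a = M.rk + 1),
    M.fcx.Phi (List.replicate a (al E)) τ = if M.rank T + a + 1 = M.rk then 1 else 0 := by
  induction a with
  | zero =>
    intro τ hτ T hT hc
    have h1 := bound_top hτ hT hc
    have h2 := rank_lt_rk (hτ.2.2.1 T hT.1) hT.2.1
    rw [if_pos (by omega)]; rfl
  | succ a ih =>
    intro τ hτ T hT hc
    have hTf := hτ.2.2.1 T hT.1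
    have h1 := bound_top hτ hT hc
    have h2 := rank_lt_rk hTf hT.2.1
    obtain ⟨i, _, hi⟩ := Finset.exists_of_ssubset (Finset.ssubset_univ_iff.2 hT.2.1)
    have hi' : ∀ F ∈ τ, F ≠ Finset.univ → i ∉ F := fun F hF hne h => hi (hT.2.2 F hF hne h)
    rw [List.replicate_succ, Phi_al hτ (by rw [List.length_replicate]; omega) hi']
    have hsub : ∀ G ∈ (M.fcx.lk τ).filter (fun G => i ∈ G), T ⊂ G := by
      intro G hG
      rw [Finset.mem_filter] at hG
      rcases (mem_flk.1 hG.1 T hT.1).2.2 with h | h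
      · exact h
      · exact absurd (h.1 hG.2) hi
    have step : ∀ G ∈ (M.fcx.lk τ).filter (fun G => i ∈ G),
        M.fcx.Phi (List.replicate a (al E)) (insert G τ) =
          if M.rank G + a + 1 = M.rk then 1 else 0 := by
      intro G hG
      have hs := hsub G hG
      rw [Finset.mem_filter] at hG
      refine ih (face_ins (C := M.fcx) hτ hG.1) ⟨Finset.mem_insert_self _ _,
        lk_ne_univ hτ hG.1, fun F hF hne => ?_⟩ (by rw [card_ins hG.1]; omega)
      rcases Finset.mem_insert.1 hF with h | h
      · rw [h]
      · exact (hT.2.2 F h hne).trans hs.1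
    rw [Finset.sum_congr rfl step]
    by_cases hr : M.rank T + (a + 1) + 1 = M.rk
    · rw [if_pos hr, Finset.sum_eq_single (M.ad T i)]
      · rw [rank_ad hTf hi, if_pos (by omega)]
      · intro G hG hne
        refine if_neg fun h => hne ?_
        have hs := hsub G hG
        rw [Finset.mem_filter] at hG
        exact (eq_ad hTf (flk_flat hτ hG.1) hs.1 (by omega) hG.2 hi).symm
      · intro h
        refine absurd ?_ h
        rw [Finset.mem_filter]
        refine ⟨mem_flk.2 (link_of_gap hτ (P := T) (Q := Finset.univ) (fun H hH => ?_) (ad_flat T i)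
          (ssubset_ad hi) (Finset.ssubset_univ_iff.2 fun h => ?_)), mem_ad T i⟩
        · by_cases hu : H = Finset.univ
          · right; rw [hu]
          · left; exact hT.2.2 H hH hu
        · have := rank_ad hTf hi
          rw [h] at this
          have : M.rk = M.rank T + 1 := this
          omega
    · rw [if_neg hr]
      refine Finset.sum_eq_zero fun G hG => if_neg ?_
      have := rank_lt hTf (hsub G hG)
      omega

/-- The recursion satisfied by the unsigned Möbius numbers. -/
def Wei (M : FinMatroid E) (nu : Finset E → ℝ) : Prop :=
  nu ∅ = 1 ∧ ∀ K, M.IsFlat K → ∀ i ∈ K,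
    nu K = ∑ G ∈ M.flats.filter (fun G => G ⊆ K ∧ i ∉ G ∧ M.rank G + 1 = M.rank K), nu G

theorem rank_pos_of {K : Finset E} (h0 : M.IsFlat ∅) (h : K ≠ ∅) : 0 < M.rank K := by
  have := rank_lt h0 (Finset.empty_ssubset.2 (Finset.nonempty_iff_ne_empty.2 h))
  omega

theorem claim_two {nu : Finset E → ℝ} (hnu : M.Wei nu) (a b : ℕ) :
    ∀ {τ : Finset (Finset E)} (_ : M.FFace τ) {T K : Finset E}
    (_ : IsTop τ T) (_ : IsBot τ K) (_ : K ⊆ T) (_ : τ.card + (b + a) = M.rk + 1),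
    M.fcx.Phi (List.replicate b (be E) ++ List.replicate a (al E)) τ =
      if M.rank T + a + 1 = M.rk ∧ M.rank K = b + 1 then nu K else 0 := by
  induction b with
  | zero =>
    intro τ hτ T K hT hK hKT hc
    have h0 := hτ.2.2.1 ∅ hτ.1
    have hKf := hτ.2.2.1 K hK.1
    have hb := bound_bot hτ hT hK hKT hc
    rw [List.replicate_zero, List.nil_append, claim_one a hτ hT (by omega)]
    have hpos := rank_pos_of h0 hK.2.1
    by_cases h : M.rank T + a + 1 = M.rk
    · have hr : M.rank K = 1 := by omega
      rw [if_pos h, if_pos ⟨h, hr⟩]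
      obtain ⟨i, hi⟩ := Finset.nonempty_iff_ne_empty.2 hK.2.1
      rw [hnu.2 K hKf i hi, Finset.sum_eq_single ∅, hnu.1]
      · intro G hG hne
        rw [Finset.mem_filter, mem_flats] at hG
        have := rank_pos_of h0 hne
        omega
      · intro h
        refine absurd ?_ h
        rw [Finset.mem_filter, mem_flats, rank_empty, hr]
        simp [h0]
    · rw [if_neg h, if_neg (fun h' => h h'.1)]
  | succ b ih =>
    intro τ hτ T K hT hK hKT hc
    have h0 := hτ.2.2.1 ∅ hτ.1
    have hKf := hτ.2.2.1 K hK.1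
    have hb := bound_bot hτ hT hK hKT hc
    obtain ⟨i, hi⟩ := Finset.nonempty_iff_ne_empty.2 hK.2.1
    have hi' : ∀ F ∈ τ, F ≠ ∅ → i ∈ F := fun F hF hne => hK.2.2 F hF hne hi
    rw [List.replicate_succ, List.cons_append, Phi_be hτ
      (by rw [List.length_append, List.length_replicate, List.length_replicate]; omega) hi']
    have hsub : ∀ G ∈ (M.fcx.lk τ).filter (fun G => i ∉ G), G ⊂ K := by
      intro G hG
      rw [Finset.mem_filter] at hG
      rcases (mem_flk.1 hG.1 K hK.1).2.2 with h | h
      · exact absurd (h.1 hi) hG.2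
      · exact h
    have step : ∀ G ∈ (M.fcx.lk τ).filter (fun G => i ∉ G),
        M.fcx.Phi (List.replicate b (be E) ++ List.replicate a (al E)) (insert G τ) =
          if M.rank T + a + 1 = M.rk ∧ M.rank G = b + 1 then nu G else 0 := by
      intro G hG
      have hs := hsub G hG
      rw [Finset.mem_filter] at hG
      refine ih (face_ins (C := M.fcx) hτ hG.1) ⟨Finset.mem_insert_of_mem hT.1, hT.2.1, ?_⟩
        ⟨Finset.mem_insert_self _ _, lk_ne_empty hτ hG.1, ?_⟩ (hs.1.trans hKT)
        (by rw [card_ins hG.1]; omega)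
      · intro F hF hne
        rcases Finset.mem_insert.1 hF with h | h
        · rw [h]; exact hs.1.trans hKT
        · exact hT.2.2 F h hne
      · intro F hF hne
        rcases Finset.mem_insert.1 hF with h | h
        · rw [h]
        · exact hs.1.trans (hK.2.2 F h hne)
    rw [Finset.sum_congr rfl step]
    by_cases h : M.rank T + a + 1 = M.rk ∧ M.rank K = b + 1 + 1
    · rw [if_pos h, hnu.2 K hKf i hi]
      rw [← Finset.sum_filter]
      refine Finset.sum_congr ?_ fun _ _ => rfl
      ext G
      rw [Finset.mem_filter, Finset.mem_filter (s := M.flats), mem_flats]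
      constructor
      · rintro ⟨hG, _, hr⟩
        have hs := hsub G hG
        rw [Finset.mem_filter] at hG
        exact ⟨flk_flat hτ hG.1, hs.1, hG.2, by omega⟩
      · rintro ⟨hGf, hGK, hiG, hr⟩
        refine ⟨Finset.mem_filter.2 ⟨mem_flk.2 (link_of_gap hτ (P := ∅) (Q := K) (fun H hH => ?_)
          hGf ?_ ?_), hiG⟩, h.1, by omega⟩
        · by_cases hu : H = ∅
          · left; rw [hu]
          · right; exact hK.2.2 H hH hu
        · refine Finset.empty_ssubset.2 (Finset.nonempty_iff_ne_empty.2 fun h' => ?_)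
          rw [h', rank_empty] at hr; omega
        · exact Finset.ssubset_iff_subset_ne.2 ⟨hGK, fun h' => hiG (h' ▸ hi)⟩
    · rw [if_neg h]
      refine Finset.sum_eq_zero fun G hG => if_neg fun h' => h ⟨h'.1, ?_⟩
      have := rank_lt (flk_flat hτ (Finset.mem_filter.1 hG).1) (hsub G hG)
      omega

/-- Reduced Whitney numbers. -/
noncomputable def wb (M : FinMatroid E) (nu : Finset E → ℝ) (e : E) (k : ℕ) : ℝ :=
  ∑ G ∈ M.flats.filter (fun G => e ∉ G ∧ M.rank G = k), nu G

theorem face_zero (h0 : M.IsFlat ∅) : M.FFace {∅, Finset.univ} := by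
  refine ⟨by simp, by simp, ?_, ?_⟩
  · intro F hF
    simp only [Finset.mem_insert, Finset.mem_singleton] at hF
    rcases hF with rfl | rfl
    · exact h0
    · exact isFlat_univ
  · intro F hF G hG
    simp only [Finset.mem_insert, Finset.mem_singleton] at hF hG
    rcases hF with rfl | rfl
    · left; simp
    · right; simp

theorem claim_three {nu : Finset E → ℝ} (hnu : M.Wei nu) (h0 : M.IsFlat ∅) (e : E) (a b : ℕ)
    (hab : a + b + 1 = M.rk) :
    M.fcx.Phi (List.replicate b (be E) ++ List.replicate a (al E)) {∅, Finset.univ} =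
      M.wb nu e b := by
  have hne : (∅ : Finset E) ≠ Finset.univ := by
    intro h
    have := Finset.mem_univ e
    rw [← h] at this; simp at this
  have hτ := face_zero h0
  have hcard : ({∅, Finset.univ} : Finset (Finset E)).card = 2 := Finset.card_pair hne
  cases b with
  | zero =>
    rw [List.replicate_zero, List.nil_append, claim_one (T := ∅) a hτ ⟨by simp, hne, by simp⟩
      (by omega), rank_empty, if_pos (by omega), wb, Finset.sum_eq_single ∅, hnu.1]
    · intro G hG hne
      rw [Finset.mem_filter, mem_flats] at hG
      have := rank_pos_of h0 hne
      omega
    · intro h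
      refine absurd ?_ h
      rw [Finset.mem_filter, mem_flats, rank_empty]
      simp [h0]
  | succ b =>
    rw [List.replicate_succ, List.cons_append, Phi_be (i := e) hτ
      (by rw [List.length_append, List.length_replicate, List.length_replicate]; omega)
      (fun F hF hne => by
        simp only [Finset.mem_insert, Finset.mem_singleton] at hF
        rw [hF.resolve_left hne]; simp)]
    have step : ∀ G ∈ (M.fcx.lk {∅, Finset.univ}).filter (fun G => e ∉ G),
        M.fcx.Phi (List.replicate b (be E) ++ List.replicate a (al E)) (insert G {∅, Finset.univ}) =
          if M.rank G + a + 1 = M.rk ∧ M.rank G = b + 1 then nu G else 0 := by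
      intro G hG
      rw [Finset.mem_filter] at hG
      refine claim_two hnu a b (face_ins (C := M.fcx) hτ hG.1)
        ⟨Finset.mem_insert_self _ _, lk_ne_univ hτ hG.1, ?_⟩
        ⟨Finset.mem_insert_self _ _, lk_ne_empty hτ hG.1, ?_⟩ subset_rfl
        (by rw [card_ins hG.1]; omega)
      · intro F hF hne
        simp only [Finset.mem_insert, Finset.mem_singleton] at hF
        rcases hF with rfl | rfl | rfl <;> simp_all
      · intro F hF hne
        simp only [Finset.mem_insert, Finset.mem_singleton] at hF
        rcases hF with rfl | rfl | rfl <;> simp_all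
    rw [Finset.sum_congr rfl step, wb, ← Finset.sum_filter]
    refine Finset.sum_congr ?_ fun _ _ => rfl
    ext G
    rw [Finset.mem_filter, Finset.mem_filter, Finset.mem_filter (s := M.flats), mem_flats]
    constructor
    · rintro ⟨hG, _, hr⟩
      exact ⟨flk_flat hτ hG.1, hG.2, hr⟩
    · rintro ⟨hGf, heG, hr⟩
      refine ⟨⟨mem_flk.2 (link_of_gap hτ (P := ∅) (Q := Finset.univ) (fun H hH => ?_)
          hGf ?_ ?_), heG⟩, by omega, hr⟩
      · simp only [Finset.mem_insert, Finset.mem_singleton] at hH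
        rcases hH with rfl | rfl <;> simp
      · refine Finset.empty_ssubset.2 (Finset.nonempty_iff_ne_empty.2 fun h' => ?_)
        rw [h', rank_empty] at hr; omega
      · exact Finset.ssubset_univ_iff.2 fun h => heG (h ▸ Finset.mem_univ e)

theorem wb_logconcave {nu : Finset E → ℝ} (hnu : M.Wei nu) (h0 : M.IsFlat ∅) (e : E) (b : ℕ)
    (hb : b + 3 ≤ M.rk) : M.wb nu e b * M.wb nu e (b + 2) ≤ M.wb nu e (b + 1) ^ 2 := by
  obtain ⟨a, ha⟩ : ∃ a, a + b + 3 = M.rk := ⟨M.rk - b - 3, by omega⟩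
  have : Nonempty E := ⟨e⟩
  obtain ⟨s, hs⟩ := exists_ample (M := M)
  have hne : (∅ : Finset E) ≠ Finset.univ := by
    intro h
    have := Finset.mem_univ e
    rw [← h] at this; simp at this
  have hτ := face_zero h0
  have hcard : ({∅, Finset.univ} : Finset (Finset E)).card = 2 := Finset.card_pair hne
  set vs := List.replicate b (be E) ++ List.replicate a (al E) with hvs
  have hlen : vs.length = b + a := by simp [hvs]
  have hN : M.fcx.N = M.rk + 1 := rfl
  have key := HR_nef (C := M.fcx) fcx_balanced fcx_conn fcx_base vs (by
      intro v hv
      simp only [hvs, List.mem_append, List.mem_replicate] at hv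
      rcases hv with h | h
      · rw [h.2]; exact be_nef
      · rw [h.2]; exact al_nef) (x := al E) (y := be E) be_nef hs hτ (by rw [hlen, hN]; omega)
  have e1 : M.fcx.Phi (al E :: al E :: vs) {∅, Finset.univ} = M.wb nu e b := by
    rw [← claim_three hnu h0 e (a + 2) b (by omega)]
    refine Phi_perm fcx_balanced ?_ hτ (by simp only [List.length_cons, hlen, hN]; omega)
    rw [List.replicate_succ, List.replicate_succ]
    exact ((List.perm_middle (a := al E)).trans ((List.perm_middle (a := al E)).cons _)).symm
  have e2 : M.fcx.Phi (be E :: be E :: vs) {∅, Finset.univ} = M.wb nu e (b + 2) := by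
    rw [← claim_three hnu h0 e a (b + 2) (by omega)]; rfl
  have e3 : M.fcx.Phi (al E :: be E :: vs) {∅, Finset.univ} = M.wb nu e (b + 1) := by
    rw [← claim_three hnu h0 e (a + 1) (b + 1) (by omega)]
    refine Phi_perm fcx_balanced ?_ hτ (by simp only [List.length_cons, hlen, hN]; omega)
    rw [List.replicate_succ (n := a)]
    exact (List.perm_middle (a := al E) (l₁ := List.replicate (b + 1) (be E))
      (l₂ := List.replicate a (al E))).symm
  rw [e1, e2, e3] at key
  exact key

end FinMatroid


namespace FinMatroid

variable {E : Type*} [Fintype E] [DecidableEq E] {M : FinMatroid E}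

theorem mob_sum {mu : Finset E → Finset E → ℤ} (hmu : M.IsMobius mu) (h0 : M.IsFlat ∅)
    {K : Finset E} (hK : M.IsFlat K) (hne : K.Nonempty) :
    ∑ G ∈ M.flats.filter (fun G => G ⊆ K), mu ∅ G = 0 := by
  rw [← hmu.2.2 ∅ (mem_flats.2 h0) K (mem_flats.2 hK) (Finset.empty_ssubset.2 hne)]
  refine Finset.sum_congr ?_ fun _ _ => rfl
  ext G
  simp

theorem ad_eq_self {G : Finset E} (hG : M.IsFlat G) {i : E} (hi : i ∈ G) : M.ad G i = G :=
  le_antisymm (ad_subset hG hi subset_rfl) (subset_ad G i)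

theorem weisner {mu : Finset E → Finset E → ℤ} (hmu : M.IsMobius mu) (h0 : M.IsFlat ∅) (i : E) :
    ∀ (n : ℕ) {K : Finset E}, M.IsFlat K → i ∈ K → K.card = n →
    ∑ G ∈ M.flats.filter (fun G => G ⊆ K ∧ M.ad G i = K), mu ∅ G = 0 := by
  intro n
  induction n using Nat.strong_induction_on with
  | _ n ih =>
    intro K hK hi hn
    have h := mob_sum hmu h0 hK ⟨i, hi⟩
    rw [← Finset.sum_fiberwise_of_maps_to (s := M.flats.filter (fun G => G ⊆ K))
      (t := M.flats.filter (fun G => G ⊆ K ∧ i ∈ G)) (g := fun G => M.ad G i)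
      (fun G hG => by
        rw [Finset.mem_filter, mem_flats] at hG ⊢
        exact ⟨ad_flat G i, ad_subset hK hi hG.2, mem_ad G i⟩)] at h
    rw [Finset.sum_eq_single K] at h
    · rw [← h]
      refine Finset.sum_congr ?_ fun _ _ => rfl
      ext G
      simp only [Finset.mem_filter, and_assoc]
    · intro K' hK' hne
      rw [Finset.mem_filter, mem_flats] at hK'
      have hlt : K' ⊂ K := Finset.ssubset_iff_subset_ne.2 ⟨hK'.2.1, hne⟩
      rw [← ih K'.card (hn ▸ Finset.card_lt_card hlt) hK'.1 hK'.2.2 rfl]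
      refine Finset.sum_congr ?_ fun _ _ => rfl
      ext G
      simp only [Finset.mem_filter, and_assoc]
      constructor
      · rintro ⟨a, _, c⟩
        exact ⟨a, c ▸ subset_ad G i, c⟩
      · rintro ⟨a, b, c⟩
        exact ⟨a, b.trans hlt.1, c⟩
    · intro h'
      refine absurd ?_ h'
      rw [Finset.mem_filter, mem_flats]
      exact ⟨hK, subset_rfl, hi⟩

theorem weisner' {mu : Finset E → Finset E → ℤ} (hmu : M.IsMobius mu) (h0 : M.IsFlat ∅) {i : E}
    {K : Finset E} (hK : M.IsFlat K) (hi : i ∈ K) :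
    mu ∅ K = - ∑ G ∈ M.flats.filter (fun G => G ⊆ K ∧ i ∉ G ∧ M.rank G + 1 = M.rank K), mu ∅ G := by
  have h := weisner hmu h0 i _ hK hi rfl
  have hmem : K ∈ M.flats.filter (fun G => G ⊆ K ∧ M.ad G i = K) := by
    rw [Finset.mem_filter, mem_flats]
    exact ⟨hK, subset_rfl, ad_eq_self hK hi⟩
  rw [← Finset.add_sum_erase _ _ hmem] at h
  rw [eq_neg_iff_add_eq_zero, ← h]
  congr 1
  refine Finset.sum_congr ?_ fun _ _ => rfl
  ext G
  simp only [Finset.mem_erase, Finset.mem_filter, mem_flats]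
  constructor
  · rintro ⟨a, b, c, d⟩
    exact ⟨fun h => by rw [h] at d; omega, a, b, eq_ad a hK b d.symm hi c⟩
  · rintro ⟨a, b, c, d⟩
    have : i ∉ G := fun hG => a ((ad_eq_self b hG).symm.trans d)
    refine ⟨b, c, this, ?_⟩
    rw [← d, rank_ad b this]

/-- The unsigned Möbius numbers. -/
noncomputable def nu (M : FinMatroid E) (mu : Finset E → Finset E → ℤ) (K : Finset E) : ℝ :=
  (-1) ^ M.rank K * (mu ∅ K : ℝ)

theorem nu_wei {mu : Finset E → Finset E → ℤ} (hmu : M.IsMobius mu) (h0 : M.IsFlat ∅) :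
    M.Wei (M.nu mu) := by
  refine ⟨?_, fun K hK i hi => ?_⟩
  · simp [nu, rank_empty, hmu.1 ∅ (mem_flats.2 h0)]
  · rw [nu, weisner' hmu h0 hK hi]
    push_cast
    rw [mul_neg, ← neg_mul, Finset.mul_sum]
    refine Finset.sum_congr rfl fun G hG => ?_
    rw [Finset.mem_filter] at hG
    rw [nu, ← hG.2.2.2, pow_succ]; ring

theorem exists_avoid (h0 : M.IsFlat ∅) {K : Finset E} (hK : M.IsFlat K) {i : E} (hi : i ∈ K)
    {k : ℕ} (hk : k < M.rank K) : ∃ G, M.IsFlat G ∧ G ⊆ K ∧ i ∉ G ∧ M.rank G = k := by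
  have h1 : M.Indep {i} := by
    obtain ⟨J, hJ, hJi, hJc⟩ := M.exists_card_eq_rank {i}
    have : M.rank {i} = 1 := by
      have := rank_insert_flat h0 (Finset.notMem_empty i)
      rw [rank_empty] at this
      simpa using this
    rw [this] at hJc
    rw [← Finset.eq_of_subset_of_card_le hJi (by simp [hJc])]
    exact hJ
  obtain ⟨J, hJ, hiJ, hJK, hJc⟩ := exists_basis h1 (Finset.singleton_subset_iff.2 hi)
  have hiJ : i ∈ J := Finset.singleton_subset_iff.1 hiJ
  obtain ⟨S, hS, hSc⟩ := Finset.exists_subset_card_eq (s := J.erase i) (n := k)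
    (by rw [Finset.card_erase_of_mem hiJ]; omega)
  have hSJ : S ⊆ J := hS.trans (Finset.erase_subset _ _)
  have hr : M.rank S = k := by
    apply le_antisymm
    · obtain ⟨I, _, hI, hIc⟩ := M.exists_card_eq_rank S
      rw [← hIc, ← hSc]; exact Finset.card_le_card hI
    · rw [← hSc]; exact card_le_rank (M.indep_subset hJ hSJ) subset_rfl
  refine ⟨M.closure S, isFlat_closure S, closure_subset_of_flat hK (hSJ.trans hJK), fun h => ?_, ?_⟩
  · rw [mem_closure, hr] at h
    have h2 := card_le_rank (M.indep_subset hJ (Finset.insert_subset hiJ hSJ)) (subset_rfl)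
    rw [h, Finset.card_insert_of_notMem (fun h => by simpa using hS h)] at h2
    omega
  · rw [rank_closure, hr]

theorem wei_pos {f : Finset E → ℝ} (hf : M.Wei f) (h0 : M.IsFlat ∅) :
    ∀ (n : ℕ) {K : Finset E}, M.IsFlat K → M.rank K = n → 0 < f K := by
  intro n
  induction n with
  | zero =>
    intro K hK hr
    have : K = ∅ := by
      by_contra h
      have := rank_pos_of h0 h
      omega
    rw [this, hf.1]; norm_num
  | succ n ih =>
    intro K hK hr
    have : K.Nonempty := by
      rw [Finset.nonempty_iff_ne_empty]
      rintro rfl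
      rw [rank_empty] at hr; omega
    obtain ⟨i, hi⟩ := this
    rw [hf.2 K hK i hi]
    refine Finset.sum_pos (fun G hG => ?_) ?_
    · rw [Finset.mem_filter, mem_flats] at hG
      exact ih hG.1 (by omega)
    · obtain ⟨G, a, b, c, d⟩ := exists_avoid h0 hK hi (k := n) (by omega)
      exact ⟨G, by rw [Finset.mem_filter, mem_flats]; exact ⟨a, b, c, by omega⟩⟩

theorem wb_pos {f : Finset E → ℝ} (hf : M.Wei f) (h0 : M.IsFlat ∅) (e : E) {k : ℕ}
    (hk : k < M.rk) : 0 < M.wb f e k := by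
  refine Finset.sum_pos (fun G hG => ?_) ?_
  · rw [Finset.mem_filter, mem_flats] at hG
    exact wei_pos hf h0 _ hG.1 rfl
  · obtain ⟨G, a, b, c, d⟩ := exists_avoid h0 isFlat_univ (Finset.mem_univ e) hk
    exact ⟨G, by rw [Finset.mem_filter, mem_flats]; exact ⟨a, c, d⟩⟩

theorem wb_zero {f : Finset E → ℝ} (e : E) {k : ℕ} (hk : M.rk ≤ k) : M.wb f e k = 0 := by
  refine Finset.sum_eq_zero fun G hG => ?_
  rw [Finset.mem_filter, mem_flats] at hG
  have : G = Finset.univ := flat_eq_of_subset hG.1 (Finset.subset_univ _) (by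
    have : M.rank Finset.univ = M.rk := rfl
    omega)
  exact absurd (this ▸ Finset.mem_univ e) hG.2.1

/-- Unsigned Whitney numbers. -/
noncomputable def wh (M : FinMatroid E) (f : Finset E → ℝ) (k : ℕ) : ℝ :=
  ∑ G ∈ M.flats.filter (fun G => M.rank G = k), f G

theorem wh_split {f : Finset E → ℝ} (e : E) (k : ℕ) :
    M.wh f k = M.wb f e k +
      ∑ G ∈ M.flats.filter (fun G => e ∈ G ∧ M.rank G = k), f G := by
  rw [wh, wb, ← Finset.sum_filter_add_sum_filter_not _ (fun G => e ∉ G)]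
  congr 1
  · refine Finset.sum_congr ?_ fun _ _ => rfl
    ext G; simp only [Finset.mem_filter]; tauto
  · refine Finset.sum_congr ?_ fun _ _ => rfl
    ext G; simp only [Finset.mem_filter]; tauto

theorem wh_zero {f : Finset E → ℝ} (h0 : M.IsFlat ∅) (e : E) : M.wh f 0 = M.wb f e 0 := by
  rw [wh_split e, Finset.sum_eq_zero, add_zero]
  intro G hG
  rw [Finset.mem_filter] at hG
  have := rank_pos_of h0 (Finset.ne_empty_of_mem hG.2.1)
  omega

theorem wh_succ {f : Finset E → ℝ} (hf : M.Wei f) (e : E) (k : ℕ) :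
    M.wh f (k + 1) = M.wb f e (k + 1) + M.wb f e k := by
  rw [wh_split e, show M.wb f e k = ∑ G ∈ M.flats.filter (fun G => e ∉ G ∧ M.rank G = k), f G
    from rfl, ← Finset.sum_fiberwise_of_maps_to
    (s := M.flats.filter (fun G => e ∉ G ∧ M.rank G = k))
      (t := M.flats.filter (fun G => e ∈ G ∧ M.rank G = k + 1)) (g := fun G => M.ad G e)
      (fun G hG => by
        rw [Finset.mem_filter, mem_flats] at hG ⊢
        exact ⟨ad_flat G e, mem_ad G e, by rw [rank_ad hG.1 hG.2.1, hG.2.2]⟩)]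
  congr 1
  refine Finset.sum_congr rfl fun K hK => ?_
  rw [Finset.mem_filter, mem_flats] at hK
  rw [hf.2 K hK.1 e hK.2.1]
  refine Finset.sum_congr ?_ fun _ _ => rfl
  ext G
  simp only [Finset.mem_filter, mem_flats]
  constructor
  · rintro ⟨a, b, c, d⟩
    exact ⟨⟨a, c, by omega⟩, eq_ad a hK.1 b (by omega) hK.2.1 c⟩
  · rintro ⟨⟨a, b, c⟩, d⟩
    exact ⟨a, d ▸ subset_ad G e, b, by omega⟩

theorem wh_logconcave {f : Finset E → ℝ} (hf : M.Wei f) (h0 : M.IsFlat ∅) (e : E) (k : ℕ)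
    (hk : k + 1 < M.rk) : M.wh f k * M.wh f (k + 2) ≤ M.wh f (k + 1) ^ 2 := by
  have lc : ∀ b, M.wb f e b * M.wb f e (b + 2) ≤ M.wb f e (b + 1) ^ 2 := by
    intro b
    by_cases h : b + 3 ≤ M.rk
    · exact wb_logconcave hf h0 e b h
    · rw [wb_zero (k := b + 2) e (by omega), mul_zero]; positivity
  rw [wh_succ hf e (k + 1), wh_succ hf e k]
  have h1 := wb_pos hf h0 e hk
  have h2 := wb_pos hf h0 e (show k < M.rk by omega)
  have h3 := lc k
  cases k with
  | zero =>
    rw [wh_zero h0 e]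
    nlinarith [mul_pos h1 h2]
  | succ k =>
    rw [wh_succ hf e k]
    have h4 := lc k
    have h5 := wb_pos hf h0 e (show k < M.rk by omega)
    have h6 : 0 ≤ M.wb f e (k + 1 + 2) := by
      by_cases h : k + 1 + 2 < M.rk
      · exact (wb_pos hf h0 e h).le
      · rw [wb_zero e (by omega)]
    generalize M.wb f e (k + 1 + 2) = t at *
    generalize M.wb f e (k + 1 + 1) = z at *
    generalize M.wb f e (k + 1) = y at *
    generalize M.wb f e k = x at *
    have h7 : x * t ≤ y * z := by
      have hyz := mul_pos h2 h1
      refine le_of_mul_le_mul_right ?_ hyz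
      have := mul_le_mul h4 h3 (by positivity) (by positivity)
      nlinarith
    nlinarith [mul_pos h1 h2]

theorem unimodal {w : ℕ → ℤ} {r : ℕ} (hpos : ∀ k ≤ r, 0 < w k)
    (hlc : ∀ k, k + 1 < r → w k * w (k + 2) ≤ w (k + 1) ^ 2) :
    ∃ i ≤ r, (∀ j k, j ≤ k → k ≤ i → w j ≤ w k) ∧
      (∀ j k, i ≤ j → j ≤ k → k ≤ r → w k ≤ w j) := by
  obtain ⟨i, hi, hmax⟩ := Finset.exists_max_image (Finset.range (r + 1)) w ⟨0, by simp⟩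
  have hi : i ≤ r := by simpa [Nat.lt_succ_iff] using hi
  have hmax : ∀ k ≤ r, w k ≤ w i := fun k hk => hmax k (by simp; omega)
  refine ⟨i, hi, ?_, ?_⟩
  · have step : ∀ j, j < i → w j ≤ w (j + 1) := by
      intro j hj
      by_contra hlt
      push Not at hlt
      have : ∀ m, j ≤ m → m + 1 ≤ r → w (m + 1) < w m ∧ w (m + 1) < w j := by
        intro m hm
        induction m, hm using Nat.le_induction with
        | base => exact fun _ => ⟨hlt, hlt⟩
        | succ m hm ih =>
          intro hr
          obtain ⟨a, b⟩ := ih (by omega)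
          have h1 := hlc m (by omega)
          have h2 := hpos m (by omega)
          have h3 := hpos (m + 1) (by omega)
          have : w (m + 1 + 1) < w (m + 1) := by
            by_contra hge
            push Not at hge
            have : w m * w (m + 1) ≤ w m * w (m + 2) := mul_le_mul_of_nonneg_left hge h2.le
            nlinarith
          exact ⟨this, by linarith⟩
      have h1 := (this (i - 1) (by omega) (by omega)).2
      rw [Nat.sub_add_cancel (by omega)] at h1
      have := hmax j (by omega)
      linarith
    intro j k hjk
    induction k, hjk using Nat.le_induction with
    | base => exact fun _ => le_rfl
    | succ k hk ih => exact fun h => (ih (by omega)).trans (step k (by omega))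
  · have step : ∀ j, i ≤ j → j + 1 ≤ r → w (j + 1) ≤ w j := by
      intro j hj
      induction j, hj using Nat.le_induction with
      | base => exact fun h => hmax _ h
      | succ m hm ih =>
        intro hr
        have a := ih (by omega)
        have h1 := hlc m (by omega)
        have h2 := hpos m (by omega)
        have h3 := hpos (m + 1) (by omega)
        by_contra hge
        push Not at hge
        have : w m * w (m + 1) < w m * w (m + 2) := mul_lt_mul_of_pos_left hge h2
        nlinarith
    intro j k hij hjk
    induction k, hjk using Nat.le_induction with
    | base => exact fun _ => le_rfl
    | succ k hk ih => exact fun h => (step k (by omega) h).trans (ih (by omega))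

theorem wh_pos {f : Finset E → ℝ} (hf : M.Wei f) (h0 : M.IsFlat ∅) {k : ℕ} (hk : k ≤ M.rk) :
    0 < M.wh f k := by
  refine Finset.sum_pos (fun G hG => ?_) ?_
  · rw [Finset.mem_filter, mem_flats] at hG
    exact wei_pos hf h0 _ hG.1 rfl
  · rcases hk.eq_or_lt with h | h
    · exact ⟨Finset.univ, by rw [Finset.mem_filter, mem_flats]; exact ⟨isFlat_univ, h.symm⟩⟩
    · have : (Finset.univ : Finset E).Nonempty := by
        rw [Finset.nonempty_iff_ne_empty]
        intro h'
        have : M.rk = M.rank Finset.univ := rfl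
        rw [h', rank_empty] at this
        omega
      obtain ⟨e, he⟩ := this
      obtain ⟨G, a, b, c, d⟩ := exists_avoid h0 isFlat_univ he h
      exact ⟨G, by rw [Finset.mem_filter, mem_flats]; exact ⟨a, d⟩⟩

theorem wh_eq {mu : Finset E → Finset E → ℤ} (hM : M.Loopless) {k : ℕ} (hk : k ≤ M.rk) :
    (((-1) ^ k * (M.charPoly mu).coeff (M.rk - k) : ℤ) : ℝ) = M.wh (M.nu mu) k := by
  rw [charPoly, if_pos hM, Polynomial.finsetSum_coeff, wh, Finset.sum_filter]
  push_cast
  rw [Finset.mul_sum]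
  refine Finset.sum_congr rfl fun G hG => ?_
  rw [Polynomial.coeff_C_mul, Polynomial.coeff_X_pow]
  have := rank_le_rk (M := M) G
  by_cases h : M.rank G = k
  · rw [if_pos h, if_pos (by omega), nu, h]; simp
  · rw [if_neg h, if_neg (by omega)]; simp

end FinMatroid
open FinMatroid in
/-- **Adiprasito–Huh–Katz (Rota–Welsh conjecture).** For a loopless matroid `M` of rank `r`,
writing `χ_M(t) = Σ_{k=0}^r w_k t^{r-k}`, the unsigned Whitney numbers of the first kind
`w_k⁺ = (-1)^k w_k` are nonnegative, log-concave, and unimodal. -/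
theorem rota_welsh {E : Type*} [Fintype E] [DecidableEq E]
    (M : FinMatroid E) (hM : M.Loopless) (r : ℕ) (hr : M.rk = r)
    (mu : Finset E → Finset E → ℤ) (hmu : M.IsMobius mu)
    (w : ℕ → ℤ) (hw : ∀ k, w k = (-1) ^ k * (M.charPoly mu).coeff (r - k)) :
    (∀ k ≤ r, 0 ≤ w k) ∧
    (∀ k, 0 < k → k < r → w (k - 1) * w (k + 1) ≤ w k ^ 2) ∧
    (∃ i ≤ r, (∀ j k, j ≤ k → k ≤ i → w j ≤ w k) ∧
      (∀ j k, i ≤ j → j ≤ k → k ≤ r → w k ≤ w j)) := by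
  subst hr
  have h0 : M.IsFlat ∅ := hM
  have hf := nu_wei hmu h0
  have hwr : ∀ k ≤ M.rk, (w k : ℝ) = M.wh (M.nu mu) k := fun k hk => by
    rw [hw k]; exact wh_eq hM hk
  have hpos : ∀ k ≤ M.rk, 0 < w k := fun k hk => by
    have := wh_pos hf h0 hk
    rw [← hwr k hk] at this
    exact_mod_cast this
  have hlc : ∀ k, k + 1 < M.rk → w k * w (k + 2) ≤ w (k + 1) ^ 2 := by
    intro k hk
    have hne : (Finset.univ : Finset E).Nonempty := by
      rw [Finset.nonempty_iff_ne_empty]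
      intro h'
      have : M.rk = M.rank Finset.univ := rfl
      rw [h', rank_empty] at this
      omega
    obtain ⟨e, _⟩ := hne
    have := wh_logconcave hf h0 e k hk
    rw [← hwr k (by omega), ← hwr (k + 1) (by omega), ← hwr (k + 2) (by omega)] at this
    exact_mod_cast this
  refine ⟨fun k hk => (hpos k hk).le, fun k hk hkr => ?_, unimodal hpos hlc⟩
  obtain ⟨k, rfl⟩ : ∃ m, k = m + 1 := ⟨k - 1, by omega⟩
  exact hlc k hkr
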